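/- (Barthe inequality, Gaussian-extremizable form.) Assume (A1) and (A2). Let fᵢ be nonnegative measurable functions on ℝ^{nᵢ}, 1 ≤ i ≤ m, and f a nonnegative measurable function on ℝⁿ satisfying f( ∑_{i=1}^m cᵢ Uᵢ* xᵢ ) ≥ ∏_{i=1}^m fᵢ(xᵢ) for all xᵢ ∈ ℝ^{nᵢ}. Then ∏_{i=1}^m ‖fᵢ‖_{1/cᵢ} ≤ ( det(A) / ∏_{i=1}^m det(Aᵢ)^{cᵢ} )^{1/2} · ∫_{ℝⁿ} f(x) dx. -/

import Mathlib

section part1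
open MeasureTheory ProbabilityTheory
open scoped ENNReal RealInnerProductSpace

set_option linter.unusedSectionVars false
set_option linter.unusedVariables false

namespace Barthe

section gauss
variable {E : Type*} [NormedAddCommGroup E] [InnerProductSpace ℝ E] [FiniteDimensional ℝ E]
  [MeasurableSpace E] [BorelSpace E]
variable {E' : Type*} [NormedAddCommGroup E'] [InnerProductSpace ℝ E'] [FiniteDimensional ℝ E']
  [MeasurableSpace E'] [BorelSpace E']

noncomputable def dens (E : Type*) [NormedAddCommGroup E] [InnerProductSpace ℝ E] (x : E) : ℝ :=
  (2 * Real.pi) ^ (-(Module.finrank ℝ E : ℝ) / 2) * Real.exp (-‖x‖ ^ 2 / 2)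

lemma dens_pos (x : E) : 0 < dens E x := by unfold dens; positivity

lemma dens_cont : Continuous (dens E) := by unfold dens; fun_prop

lemma dens_le (x : E) : dens E x ≤ (2 * Real.pi) ^ (-(Module.finrank ℝ E : ℝ) / 2) := by
  unfold dens
  have : Real.exp (-‖x‖ ^ 2 / 2) ≤ 1 := Real.exp_le_one_iff.2 (by nlinarith [sq_nonneg ‖x‖])
  have h2 : 0 < (2 * Real.pi) ^ (-(Module.finrank ℝ E : ℝ) / 2) := by positivity
  nlinarith

lemma integrable_exp_sq : Integrable (fun x : E => Real.exp (-‖x‖ ^ 2 / 2)) := by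
  have := (GaussianFourier.integrable_cexp_neg_mul_sq_norm_add (V := E) (b := 1/2) (by norm_num) 0 0).norm
  refine this.congr (Filter.Eventually.of_forall fun x => ?_)
  simp only [Complex.norm_exp]
  congr 1
  simp
  norm_cast
  ring

lemma dens_integrable : Integrable (dens E) := integrable_exp_sq.const_mul _

lemma stdGaussian_eq : stdGaussian E = volume.withDensity (fun x => ENNReal.ofReal (dens E x)) := by
  have hfin : IsFiniteMeasure (volume.withDensity (fun x : E => ENNReal.ofReal (dens E x))) :=
    isFiniteMeasure_withDensity_ofReal dens_integrable.2
  apply Measure.ext_of_charFun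
  ext t
  rw [charFun_stdGaussian, charFun_apply, integral_withDensity_eq_integral_toReal_smul
    (by have := dens_cont (E := E); fun_prop) (by simp)]
  have := GaussianFourier.integral_cexp_neg_mul_sq_norm_add (V := E) (b := 1/2) (by norm_num) Complex.I t
  have h2 : ∀ x : E, (ENNReal.ofReal (dens E x)).toReal • Complex.exp (⟪x, t⟫ * Complex.I) =
     (((2 * Real.pi) ^ (-(Module.finrank ℝ E : ℝ) / 2) : ℝ) : ℂ) *
      Complex.exp (-(1/2) * ‖x‖ ^ 2 + Complex.I * ⟪t, x⟫) := by
    intro x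
    rw [ENNReal.toReal_ofReal (dens_pos x).le, dens, Complex.real_smul, real_inner_comm]
    push_cast
    rw [mul_assoc, ← Complex.exp_add]
    ring_nf
  simp_rw [h2]
  rw [integral_const_mul, this, Complex.ofReal_cpow (by positivity)]
  have h3 : (Real.pi : ℂ) / (1/2) = ((2 * Real.pi : ℝ) : ℂ) := by push_cast; ring
  rw [h3, ← mul_assoc, ← Complex.cpow_add]
  · push_cast
    simp
    ring_nf
    simp
  · exact_mod_cast (by positivity : (2 * Real.pi) ≠ 0)

lemma integral_gauss (F : E → ℝ) : ∫ x, F x ∂(stdGaussian E) = ∫ x, dens E x * F x := by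
  rw [stdGaussian_eq, integral_withDensity_eq_integral_toReal_smul
    (by have := dens_cont (E := E); fun_prop) (by simp)]
  simp [ENNReal.toReal_ofReal (dens_pos _).le]

lemma gauss_shift (F : E → ℝ) (w : E) :
    ∫ x, F (x + w) * Real.exp (-⟪x, w⟫ - ‖w‖ ^ 2 / 2) ∂(stdGaussian E) = ∫ x, F x ∂(stdGaussian E) := by
  rw [integral_gauss, integral_gauss, ← integral_add_right_eq_self (fun x => dens E x * F x) w]
  congr 1; ext x
  have : dens E (x + w) = dens E x * Real.exp (-⟪x, w⟫ - ‖w‖ ^ 2 / 2) := by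
    unfold dens
    rw [mul_assoc, ← Real.exp_add, norm_add_sq_real]
    ring_nf
  rw [this]; ring

lemma gauss_map (V : E →L[ℝ] E') (hV : ∀ y, ‖V.adjoint y‖ = ‖y‖) :
    (stdGaussian E).map V = stdGaussian E' := by
  apply Measure.ext_of_charFun
  ext t
  rw [charFun_stdGaussian, charFun_apply, integral_map (by fun_prop) (by fun_prop)]
  have := charFun_stdGaussian (V.adjoint t)
  rw [charFun_apply] at this
  simp_rw [← ContinuousLinearMap.adjoint_inner_right, this, hV]

lemma gauss_semi (s t : ℝ) (hs : 0 ≤ s) (ht : 0 ≤ t) :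
    ((stdGaussian E).prod (stdGaussian E)).map (fun z => √s • z.1 + √t • z.2)
      = (stdGaussian E).map (fun x => √(s + t) • x) := by
  apply Measure.ext_of_charFun
  ext u
  rw [charFun_map_smul, charFun_stdGaussian, charFun_apply, integral_map (by fun_prop) (by fun_prop)]
  have h : ∀ z : E × E, Complex.exp (⟪√s • z.1 + √t • z.2, u⟫ * Complex.I) =
     Complex.exp (⟪z.1, √s • u⟫ * Complex.I) * Complex.exp (⟪z.2, √t • u⟫ * Complex.I) := by
    intro z
    rw [← Complex.exp_add, inner_add_left, inner_smul_left, inner_smul_left, inner_smul_right, inner_smul_right]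
    push_cast; simp; ring_nf
  simp_rw [h]
  rw [integral_prod_mul (fun z : E => Complex.exp (⟪z, √s • u⟫ * Complex.I)) (fun z : E => Complex.exp (⟪z, √t • u⟫ * Complex.I)),
    ← charFun_apply, ← charFun_apply, charFun_stdGaussian, charFun_stdGaussian, ← Complex.exp_add]
  congr 1
  simp only [norm_smul, Real.norm_eq_abs]
  norm_cast
  simp only [mul_pow, sq_abs, Real.sq_sqrt hs, Real.sq_sqrt ht, Real.sq_sqrt (add_nonneg hs ht)]
  ring

lemma gauss_mom (k : ℕ) : Integrable (fun x : E => ‖x‖ ^ k) (stdGaussian E) := by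
  have := IsGaussian.memLp_id (stdGaussian E) k (by simp)
  exact this.integrable_norm_pow' 

lemma gauss_inner_integrable (u : E) : Integrable (fun x : E => ⟪u, x⟫) (stdGaussian E) := by
  have := (gauss_mom (E := E) 1).const_mul ‖u‖
  refine this.mono' (by fun_prop) (Filter.Eventually.of_forall fun x => ?_)
  simpa using abs_real_inner_le_norm u x

lemma gauss_inner_sq_integrable (u : E) : Integrable (fun x : E => ⟪u, x⟫ ^ 2) (stdGaussian E) := by
  have := (gauss_mom (E := E) 2).const_mul (‖u‖ ^ 2)
  refine this.mono' (by fun_prop) (Filter.Eventually.of_forall fun x => ?_)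
  rw [← mul_pow]
  simpa using sq_le_sq' (by linarith [abs_real_inner_le_norm u x, neg_abs_le ⟪u,x⟫]) (real_inner_le_norm u x)

lemma gauss_inner (u : E) : ∫ x, ⟪u, x⟫ ∂(stdGaussian E) = 0 := by
  simpa using integral_strongDual_stdGaussian (innerSL ℝ u)

lemma gauss_inner_sq (u : E) : ∫ x, ⟪u, x⟫ ^ 2 ∂(stdGaussian E) = ‖u‖ ^ 2 := by
  have := variance_dual_stdGaussian (innerSL ℝ u)
  rw [variance_of_integral_eq_zero (by fun_prop) (integral_strongDual_stdGaussian _)] at this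
  simpa using this

end gauss
end Barthe
end part1

section part2
open MeasureTheory ProbabilityTheory
open scoped ENNReal RealInnerProductSpace
set_option linter.unusedSectionVars false
set_option linter.unusedVariables false

namespace Barthe

section nice
variable {E : Type*} [NormedAddCommGroup E] [InnerProductSpace ℝ E] [FiniteDimensional ℝ E]
  [MeasurableSpace E] [BorelSpace E]

/-- Bounded functions with a bounded Lipschitz gradient field. -/
structure Nice (K : ℝ) (p : E → ℝ) (a : E → E) : Prop where
  bd : ∀ x, |p x| ≤ K
  ab : ∀ x, ‖a x‖ ≤ K
  al : ∀ x y, ‖a x - a y‖ ≤ K * ‖x - y‖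
  lip : ∀ x y, |p x - p y| ≤ K * ‖x - y‖
  ty : ∀ x v, |p (x + v) - p x - ⟪a x, v⟫| ≤ K * ‖v‖ ^ 2

lemma Nice.nonneg {K : ℝ} {p : E → ℝ} {a : E → E} (h : Nice K p a) : 0 ≤ K :=
  (abs_nonneg _).trans (h.bd 0)

lemma Nice.mono {K K' : ℝ} {p : E → ℝ} {a : E → E} (h : Nice K p a) (hK : K ≤ K') : Nice K' p a where
  bd x := (h.bd x).trans hK
  ab x := (h.ab x).trans hK
  al x y := (h.al x y).trans (by gcongr)
  lip x y := (h.lip x y).trans (by gcongr)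
  ty x v := (h.ty x v).trans (by gcongr)

lemma Nice.cont {K : ℝ} {p : E → ℝ} {a : E → E} (h : Nice K p a) : Continuous p := by
  refine (LipschitzWith.of_dist_le_mul (K := K.toNNReal) fun x y => ?_).continuous
  rw [Real.coe_toNNReal _ h.nonneg, Real.dist_eq, dist_eq_norm]
  exact h.lip x y

lemma Nice.acont {K : ℝ} {p : E → ℝ} {a : E → E} (h : Nice K p a) : Continuous a := by
  refine (LipschitzWith.of_dist_le_mul (K := K.toNNReal) fun x y => ?_).continuous
  rw [Real.coe_toNNReal _ h.nonneg, dist_eq_norm, dist_eq_norm]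
  exact h.al x y

/-- Heat operator. -/
noncomputable def heat (t : ℝ) (p : E → ℝ) (x : E) : ℝ := ∫ z, p (x + √t • z) ∂(stdGaussian E)

lemma int_bdd {Ω : Type*} [MeasurableSpace Ω] {μ : Measure Ω} [IsFiniteMeasure μ] {F : Type*}
    [NormedAddCommGroup F] {f : Ω → F} (C : ℝ)
    (hf : AEStronglyMeasurable f μ) (hC : ∀ x, ‖f x‖ ≤ C) : Integrable f μ :=
  Integrable.of_bound hf C (Filter.Eventually.of_forall hC)

lemma norm_int_le {Ω : Type*} [MeasurableSpace Ω] {μ : Measure Ω} [IsProbabilityMeasure μ] {F : Type*}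
    [NormedAddCommGroup F] [NormedSpace ℝ F] {f : Ω → F} (C : ℝ) (hC : ∀ x, ‖f x‖ ≤ C) : ‖∫ x, f x ∂μ‖ ≤ C := by
  simpa using norm_integral_le_of_norm_le_const (μ := μ) (Filter.Eventually.of_forall hC)

lemma Nice.heat {K : ℝ} {p : E → ℝ} {a : E → E} (h : Nice K p a) (t : ℝ) :
    Nice K (heat t p) (fun x => ∫ z, a (x + √t • z) ∂(stdGaussian E)) := by
  have hp := h.cont
  have ha := h.acont
  have ip : ∀ x, Integrable (fun z => p (x + √t • z)) (stdGaussian E) := fun x =>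
    int_bdd K (by fun_prop) (fun z => h.bd _)
  have ia : ∀ x, Integrable (fun z => a (x + √t • z)) (stdGaussian E) := fun x =>
    int_bdd K (by fun_prop) (fun z => h.ab _)
  refine ⟨fun x => by unfold Barthe.heat; rw [← Real.norm_eq_abs]; exact norm_int_le K fun z => h.bd _, fun x => norm_int_le K fun z => h.ab _, fun x y => ?_,
    fun x y => ?_, fun x v => ?_⟩
  · rw [← integral_sub (ia x) (ia y)]
    refine norm_int_le _ fun z => ?_
    simpa using h.al (x + √t • z) (y + √t • z)
  · unfold Barthe.heat
    rw [← integral_sub (ip x) (ip y), ← Real.norm_eq_abs]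
    refine norm_int_le _ fun z => ?_
    simpa using h.lip (x + √t • z) (y + √t • z)
  · unfold Barthe.heat
    rw [real_inner_comm, ← integral_inner (ia x), ← integral_sub (ip _) (ip x), ← integral_sub (by exact (ip _).sub (ip x)) ((ia x).const_inner v), ← Real.norm_eq_abs]
    refine norm_int_le _ fun z => ?_
    have := h.ty (x + √t • z) v
    rw [Real.norm_eq_abs, real_inner_comm]
    rwa [add_right_comm] at this

lemma Nice.comp {K L : ℝ} {p : E → ℝ} {a : E → E} (h : Nice K p a) (I : Set ℝ) (hI : ∀ x, p x ∈ I)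
    (G G' : ℝ → ℝ) (h1 : ∀ r ∈ I, |G r| ≤ L) (h2 : ∀ r ∈ I, |G' r| ≤ L)
    (h3 : ∀ r ∈ I, ∀ s ∈ I, |G s - G r| ≤ L * |s - r|)
    (h4 : ∀ r ∈ I, ∀ s ∈ I, |G' s - G' r| ≤ L * |s - r|)
    (h5 : ∀ r ∈ I, ∀ s ∈ I, |G s - G r - G' r * (s - r)| ≤ L * |s - r| ^ 2) :
    Nice (L + 2 * (L * K) + 2 * (L * K ^ 2)) (fun x => G (p x)) (fun x => G' (p x) • a x) := by
  have hK := h.nonneg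
  have hL : 0 ≤ L := (abs_nonneg _).trans (h1 _ (hI 0))
  have hLK : 0 ≤ L * K := by positivity
  have hLK2 : 0 ≤ L * K ^ 2 := by positivity
  refine ⟨fun x => (h1 _ (hI x)).trans (by linarith), fun x => ?_, fun x y => ?_, fun x y => ?_, fun x v => ?_⟩
  · rw [norm_smul]
    calc _ ≤ L * K := mul_le_mul (h2 _ (hI x)) (h.ab x) (norm_nonneg _) hL
      _ ≤ _ := by linarith
  · have : G' (p x) • a x - G' (p y) • a y = G' (p x) • (a x - a y) + (G' (p x) - G' (p y)) • a y := by
      rw [smul_sub, sub_smul]; abel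
    rw [this]
    calc _ ≤ ‖G' (p x) • (a x - a y)‖ + ‖(G' (p x) - G' (p y)) • a y‖ := norm_add_le _ _
      _ ≤ L * (K * ‖x - y‖) + (L * (K * ‖x - y‖)) * K := by
        rw [norm_smul, norm_smul]
        gcongr
        · exact h2 _ (hI x)
        · exact h.al x y
        · exact (h4 _ (hI y) _ (hI x)).trans (by gcongr; exact h.lip x y)
        · exact h.ab y
      _ ≤ _ := by nlinarith [norm_nonneg (x - y), mul_nonneg hL (norm_nonneg (x - y)), mul_nonneg hLK (norm_nonneg (x - y)), mul_nonneg hLK2 (norm_nonneg (x - y))]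
  · calc _ ≤ L * (K * ‖x - y‖) := (h3 _ (hI y) _ (hI x)).trans (by gcongr; exact h.lip x y)
      _ ≤ _ := by nlinarith [norm_nonneg (x - y), mul_nonneg hL (norm_nonneg (x - y)), mul_nonneg hLK (norm_nonneg (x - y)), mul_nonneg hLK2 (norm_nonneg (x - y))]
  · have e : G (p (x + v)) - G (p x) - ⟪G' (p x) • a x, v⟫ = (G (p (x + v)) - G (p x) - G' (p x) * (p (x + v) - p x))
       + G' (p x) * (p (x + v) - p x - ⟪a x, v⟫) := by
      rw [real_inner_smul_left]; ring
    rw [e]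
    have l := h.lip (x + v) x
    rw [add_sub_cancel_left] at l
    calc _ ≤ _ := abs_add_le _ _
      _ ≤ L * (K * ‖v‖) ^ 2 + L * (K * ‖v‖ ^ 2) := by
        rw [abs_mul]
        gcongr
        · exact (h5 _ (hI x) _ (hI _)).trans (by gcongr)
        · exact h2 _ (hI x)
        · exact h.ty x v
      _ ≤ _ := by nlinarith [mul_nonneg hL (sq_nonneg ‖v‖), mul_nonneg hLK (sq_nonneg ‖v‖), mul_nonneg hLK2 (sq_nonneg ‖v‖)]

lemma exp_sub_le (r s : ℝ) : Real.exp s - Real.exp r ≤ Real.exp s * (s - r) := by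
  have := Real.add_one_le_exp (r - s)
  have h2 : Real.exp r = Real.exp s * Real.exp (r - s) := by rw [← Real.exp_add]; ring_nf
  rw [h2]; nlinarith [Real.exp_pos s]

lemma exp_lip {K r s : ℝ} (hr : |r| ≤ K) (hs : |s| ≤ K) : |Real.exp s - Real.exp r| ≤ Real.exp K * |s - r| := by
  have a1 := exp_sub_le r s
  have a2 := exp_sub_le s r
  have b1 := Real.exp_le_exp.2 (abs_le.1 hr).2
  have b2 := Real.exp_le_exp.2 (abs_le.1 hs).2
  rw [abs_le]
  constructor
  · have : Real.exp r * (r - s) ≤ Real.exp K * |s - r| := by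
      rw [abs_sub_comm]
      nlinarith [Real.exp_pos r, le_abs_self (r-s), abs_nonneg (r - s)]
    linarith
  · have : Real.exp s * (s - r) ≤ Real.exp K * |s - r| := by
      nlinarith [Real.exp_pos s, le_abs_self (s-r), abs_nonneg (s - r)]
    linarith

lemma Nice.exp {K : ℝ} {p : E → ℝ} {a : E → E} (h : Nice K p a) :
    ∃ K' b, Nice K' (fun x => Real.exp (p x)) b := by
  refine ⟨_, _, h.comp {r | |r| ≤ K} h.bd Real.exp Real.exp (L := Real.exp K) ?_ ?_ ?_ ?_ ?_⟩
  · intro r hr; rw [abs_of_pos (Real.exp_pos _)]; exact Real.exp_le_exp.2 (abs_le.1 hr).2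
  · intro r hr; rw [abs_of_pos (Real.exp_pos _)]; exact Real.exp_le_exp.2 (abs_le.1 hr).2
  · intro r hr s hs; exact exp_lip hr hs
  · intro r hr s hs; exact exp_lip hr hs
  · intro r hr s hs
    have a1 := exp_sub_le r s
    have a2 := exp_sub_le s r
    have l := exp_lip hr hs
    rw [abs_of_nonneg (by linarith)]
    have : (Real.exp s - Real.exp r) * (s - r) ≤ (Real.exp K * |s - r|) * |s - r| :=
      (le_abs_self _).trans (by rw [abs_mul]; gcongr)
    nlinarith

lemma log_sub_le {r s : ℝ} (hr : 0 < r) (hs : 0 < s) : Real.log s - Real.log r ≤ (s - r) / r := by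
  rw [← Real.log_div hs.ne' hr.ne']
  have := Real.log_le_sub_one_of_pos (div_pos hs hr)
  rw [sub_div, div_self hr.ne']; exact this

lemma Nice.log {K e : ℝ} (he : 0 < e) : ∃ K', ∀ {p : E → ℝ} {a : E → E} (h : Nice K p a) (hpe : ∀ x, e ≤ p x),
    ∃ b, Nice K' (fun x => Real.log (p x)) b := by
  set L := |Real.log e| + |Real.log K| + 1 / e + 1 / e ^ 2 with hLd
  have i1 : 0 < 1 / e := by positivity
  have i2 : 0 < 1 / e ^ 2 := by positivity
  have l3 : 1 / e ≤ L := by have := abs_nonneg (Real.log e); have := abs_nonneg (Real.log K); linarith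
  have l4 : 1 / e ^ 2 ≤ L := by have := abs_nonneg (Real.log e); have := abs_nonneg (Real.log K); linarith
  have inv_lip : ∀ r s : ℝ, e ≤ r → e ≤ s → |s⁻¹ - r⁻¹| ≤ 1 / e ^ 2 * |s - r| := by
    intro r s hr hs
    have hr0 := he.trans_le hr
    have hs0 := he.trans_le hs
    rw [inv_sub_inv hs0.ne' hr0.ne', abs_div, abs_sub_comm r s, abs_of_pos (mul_pos hs0 hr0), div_eq_mul_one_div, mul_comm]
    gcongr
    nlinarith
  have log_lip : ∀ r s : ℝ, e ≤ r → e ≤ s → |Real.log s - Real.log r| ≤ 1 / e * |s - r| := by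
    intro r s hr hs
    have hr0 := he.trans_le hr
    have hs0 := he.trans_le hs
    have q : ∀ x y : ℝ, e ≤ x → e ≤ y → (y - x) / x ≤ 1 / e * |y - x| := by
      intro x y hx hy
      calc (y - x) / x ≤ |y - x| / x := by gcongr; exact (he.trans_le hx).le; exact le_abs_self _
        _ ≤ |y - x| / e := by gcongr
        _ = _ := by ring
    rw [abs_le]
    constructor
    · have := (log_sub_le hs0 hr0).trans (q s r hs hr); rw [abs_sub_comm] at this; linarith
    · exact (log_sub_le hr0 hs0).trans (q r s hr hs)
  refine ⟨L + 2 * (L * K) + 2 * (L * K ^ 2), fun {p a} h hpe => ⟨_, h.comp {r | e ≤ r ∧ r ≤ K} (fun x => ⟨hpe x, (le_abs_self _).trans (h.bd x)⟩) Real.log (fun r => r⁻¹) (L := L) ?_ ?_ ?_ ?_ ?_⟩⟩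
  · rintro r ⟨hr, hr'⟩
    have q1 := Real.log_le_log he hr
    have q2 := Real.log_le_log (he.trans_le hr) hr'
    rw [abs_le]
    constructor <;> linarith [neg_abs_le (Real.log e), le_abs_self (Real.log K), abs_nonneg (Real.log e), abs_nonneg (Real.log K)]
  · rintro r ⟨hr, hr'⟩
    rw [abs_of_pos (inv_pos.2 (he.trans_le hr))]
    refine le_trans ?_ l3
    rw [one_div]; gcongr
  · rintro r ⟨hr, hr'⟩ s ⟨hs, hs'⟩
    exact (log_lip r s hr hs).trans (by gcongr)
  · rintro r ⟨hr, hr'⟩ s ⟨hs, hs'⟩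
    exact (inv_lip r s hr hs).trans (by gcongr)
  · rintro r ⟨hr, hr'⟩ s ⟨hs, hs'⟩
    have hr0 := he.trans_le hr
    have hs0 := he.trans_le hs
    have a1 := log_sub_le hr0 hs0
    have a2 := log_sub_le hs0 hr0
    rw [abs_sub_comm, abs_of_nonneg (by rw [sub_nonneg, mul_comm, ← div_eq_mul_inv]; exact a1)]
    have : (r⁻¹ - s⁻¹) * (s - r) ≤ (1 / e ^ 2 * |s - r|) * |s - r| :=
      (le_abs_self _).trans (by rw [abs_mul]; gcongr; rw [abs_sub_comm]; exact inv_lip r s hr hs)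
    have t2 : (1 / e ^ 2 * |s - r|) * |s - r| ≤ L * |s - r| ^ 2 := by
      rw [mul_assoc, ← sq]; gcongr
    have t3 : (r - s) / s = s⁻¹ * (r - s) := by rw [div_eq_mul_inv, mul_comm]
    nlinarith

lemma exp_taylor {K y : ℝ} (hy : |y| ≤ K) : Real.exp y ≤ 1 + y + y ^ 2 / 2 + Real.exp K * |y| ^ 3 := by
  have h := Complex.norm_exp_sub_sum_le_norm_mul_exp (y : ℂ) 3
  simp only [Finset.sum_range_succ, Finset.sum_range_zero, ← Complex.ofReal_exp] at h
  norm_cast at h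
  simp only [Real.norm_eq_abs, Nat.factorial] at h
  have := (le_abs_self _).trans h
  have h2 : |y| ^ 3 * Real.exp |y| ≤ Real.exp K * |y| ^ 3 := by
    rw [mul_comm]; gcongr
  norm_num at this
  linarith

/-- One step estimate for a single function. -/
lemma one_step (E : Type*) [NormedAddCommGroup E] [InnerProductSpace ℝ E] [FiniteDimensional ℝ E]
  [MeasurableSpace E] [BorelSpace E] (K : ℝ) : ∃ C, 0 ≤ C ∧ ∀ {p : E → ℝ} {a : E → E}, Nice K p a →
    ∀ (x : E) (d : ℝ), 0 ≤ d → d ≤ 1 →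
    Real.log (∫ z, Real.exp (p (x + d • z)) ∂(stdGaussian E)) - C * d ^ 3 ≤
      ∫ z, p (x + d • z + d ^ 2 • a x) ∂(stdGaussian E) - d ^ 2 * ‖a x‖ ^ 2 / 2 := by
  set m1 := ∫ z : E, ‖z‖ ^ 1 ∂(stdGaussian E) with hm1
  set m3 := ∫ z : E, ‖z‖ ^ 3 ∂(stdGaussian E) with hm3
  have hm1' : 0 ≤ m1 := integral_nonneg fun z => by positivity
  have hm3' : 0 ≤ m3 := integral_nonneg fun z => by positivity
  set C2 := Real.exp (2 * K) * |K| ^ 3 + K ^ 2 with hC2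
  have hC2' : 0 ≤ C2 := by positivity
  refine ⟨C2 * m3 + K ^ 2 * m1 + |K| ^ 3, by positivity, fun {p a} h x d hd hd1 => ?_⟩
  have hK := h.nonneg
  rw [abs_of_nonneg hK] at *
  have hp := h.cont
  have ha := h.acont
  set u := a x with hu
  have hu' : ‖u‖ ≤ K := h.ab x
  have i0 : Integrable (fun z => p (x + d • z)) (stdGaussian E) := int_bdd K (by fun_prop) (fun z => h.bd _)
  have i1 : Integrable (fun z => p (x + d • z + d ^ 2 • u)) (stdGaussian E) :=
    int_bdd K (by fun_prop) (fun z => h.bd _)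
  have ie : Integrable (fun z => Real.exp (p (x + d • z))) (stdGaussian E) :=
    int_bdd (Real.exp K) (by fun_prop) (fun z => by
      rw [Real.norm_eq_abs, abs_of_pos (Real.exp_pos _)]
      exact Real.exp_le_exp.2 ((le_abs_self _).trans (h.bd _)))
  have n1 := gauss_mom (E := E) 1
  have n3 := gauss_mom (E := E) 3
  -- part (i)
  have A : ∀ z : E, p (x + d • z) + (d ^ 2 * ‖u‖ ^ 2 - K ^ 3 * d ^ 3) - (K ^ 2 * d ^ 3) * ‖z‖ ^ 1 ≤ p (x + d • z + d ^ 2 • u) := by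
    intro z
    have t := (abs_le.1 (h.ty (x + d • z) (d ^ 2 • u))).1
    have al := h.al (x + d • z) x
    rw [add_sub_cancel_left, norm_smul, Real.norm_eq_abs, abs_of_nonneg hd, ← hu] at al
    rw [inner_smul_right, norm_smul, Real.norm_eq_abs, abs_of_nonneg (sq_nonneg d)] at t
    have q : ⟪a (x + d • z), u⟫ = ‖u‖ ^ 2 + ⟪a (x + d • z) - u, u⟫ := by
      rw [inner_sub_left, real_inner_self_eq_norm_sq]; ring
    have q2 : -(K * (d * ‖z‖) * K) ≤ ⟪a (x + d • z) - u, u⟫ := by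
      have := (abs_le.1 (abs_real_inner_le_norm (a (x + d • z) - u) u)).1
      have : ‖a (x + d • z) - u‖ * ‖u‖ ≤ K * (d * ‖z‖) * K := by gcongr
      linarith
    have q3 : K * (d ^ 2 * ‖u‖) ^ 2 ≤ K ^ 3 * d ^ 3 := by
      calc K * (d ^ 2 * ‖u‖) ^ 2 ≤ K * (d ^ 2 * K) ^ 2 := by gcongr
        _ = K ^ 3 * d ^ 3 * d := by ring
        _ ≤ K ^ 3 * d ^ 3 * 1 := by gcongr
        _ = _ := by ring
    have q4 : d ^ 2 * (-(K * (d * ‖z‖) * K)) ≤ d ^ 2 * ⟪a (x + d • z) - u, u⟫ := by gcongr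
    rw [q] at t
    rw [pow_one]
    nlinarith
  have A' : (∫ z, p (x + d • z) ∂(stdGaussian E)) + (d ^ 2 * ‖u‖ ^ 2 - K ^ 3 * d ^ 3) - (K ^ 2 * d ^ 3) * m1 ≤
      ∫ z, p (x + d • z + d ^ 2 • u) ∂(stdGaussian E) := by
    have := integral_mono ((i0.add (integrable_const (d ^ 2 * ‖u‖ ^ 2 - K ^ 3 * d ^ 3))).sub (n1.const_mul (K ^ 2 * d ^ 3))) i1 A
    rw [integral_sub' (i0.add (integrable_const _)) (n1.const_mul _), integral_add' i0 (integrable_const _), integral_const_mul] at this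
    simpa [hm1] using this
  -- part (ii)
  have B : ∀ z : E, Real.exp (p (x + d • z)) ≤ Real.exp (p x) * (1 - p x + p (x + d • z) + (d ^ 2 / 2) * ⟪u, z⟫ ^ 2
      + (C2 * d ^ 3) * ‖z‖ ^ 3) := by
    intro z
    set Y := p (x + d • z) - p x with hY
    have e : Real.exp (p (x + d • z)) = Real.exp (p x) * Real.exp Y := by rw [← Real.exp_add]; congr 1; rw [hY]; ring
    rw [e]
    gcongr
    have hYb : |Y| ≤ 2 * K := by
      calc |Y| ≤ |p (x + d • z)| + |p x| := abs_sub _ _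
        _ ≤ _ := by linarith [h.bd (x + d • z), h.bd x]
    have hYl : |Y| ≤ K * (d * ‖z‖) := by
      have := h.lip (x + d • z) x
      rwa [add_sub_cancel_left, norm_smul, Real.norm_eq_abs, abs_of_nonneg hd] at this
    have hYt : |Y - d * ⟪u, z⟫| ≤ K * (d * ‖z‖) ^ 2 := by
      have := h.ty x (d • z)
      rwa [norm_smul, Real.norm_eq_abs, abs_of_nonneg hd, inner_smul_right] at this
    have hYs : |Y + d * ⟪u, z⟫| ≤ 2 * (K * (d * ‖z‖)) := by
      have : |d * ⟪u, z⟫| ≤ K * (d * ‖z‖) := by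
        rw [abs_mul, abs_of_nonneg hd]
        calc d * |⟪u, z⟫| ≤ d * (K * ‖z‖) := by
              gcongr; exact (abs_real_inner_le_norm _ _).trans (by gcongr)
          _ = _ := by ring
      exact (abs_add_le _ _).trans (by linarith)
    have hY2 : Y ^ 2 ≤ d ^ 2 * ⟪u, z⟫ ^ 2 + 2 * K ^ 2 * d ^ 3 * ‖z‖ ^ 3 := by
      have : (Y - d * ⟪u, z⟫) * (Y + d * ⟪u, z⟫) ≤ K * (d * ‖z‖) ^ 2 * (2 * (K * (d * ‖z‖))) :=
        (le_abs_self _).trans (by rw [abs_mul]; gcongr)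
      nlinarith
    have hY3 : Real.exp (2 * K) * |Y| ^ 3 ≤ Real.exp (2 * K) * (K * (d * ‖z‖)) ^ 3 := by gcongr
    have := exp_taylor hYb
    rw [hC2]
    nlinarith
  have B' : ∫ z, Real.exp (p (x + d • z)) ∂(stdGaussian E) ≤ Real.exp (p x) * (1 - p x + (∫ z, p (x + d • z) ∂(stdGaussian E))
      + (d ^ 2 / 2) * ‖u‖ ^ 2 + (C2 * d ^ 3) * m3) := by
    have j1 := (integrable_const (μ := stdGaussian E) (1 - p x)).add i0
    have j2 := (gauss_inner_sq_integrable u).const_mul (d ^ 2 / 2)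
    have j3 := n3.const_mul (C2 * d ^ 3)
    have := integral_mono ie (((j1.add j2).add j3).const_mul (Real.exp (p x))) B
    rw [integral_const_mul, integral_add' (j1.add j2) j3, integral_add' j1 j2, integral_add' (integrable_const _) i0,
      integral_const_mul, integral_const_mul, gauss_inner_sq] at this
    simpa using this
  have hpos : 0 < ∫ z, Real.exp (p (x + d • z)) ∂(stdGaussian E) := integral_exp_pos ie
  have Bpp : Real.log (∫ z, Real.exp (p (x + d • z)) ∂(stdGaussian E)) ≤ (∫ z, p (x + d • z) ∂(stdGaussian E))
      + (d ^ 2 / 2) * ‖u‖ ^ 2 + (C2 * d ^ 3) * m3 := by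
    rw [Real.log_le_iff_le_exp hpos]
    set T := (∫ z, p (x + d • z) ∂(stdGaussian E)) + (d ^ 2 / 2) * ‖u‖ ^ 2 + (C2 * d ^ 3) * m3 with hT
    have e : Real.exp T = Real.exp (p x) * Real.exp (T - p x) := by rw [← Real.exp_add]; congr 1; ring
    rw [e]
    refine B'.trans ?_
    gcongr
    have := Real.add_one_le_exp (T - p x)
    linarith
  nlinarith

end nice
end Barthe
end part2

section part3
open MeasureTheory ProbabilityTheory
open scoped ENNReal RealInnerProductSpace
set_option linter.unusedSectionVars false
set_option linter.unusedVariables false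

namespace Barthe

section heat
variable {E : Type*} [NormedAddCommGroup E] [InnerProductSpace ℝ E] [FiniteDimensional ℝ E]
  [MeasurableSpace E] [BorelSpace E]

lemma heat_zero (F : E → ℝ) : heat 0 F = F := by
  ext x; simp [heat]

lemma heat_int {F : E → ℝ} (hF : Measurable F) {B : ℝ} (hB : ∀ x, |F x| ≤ B) (t : ℝ) (x : E) :
    Integrable (fun z => F (x + √t • z)) (stdGaussian E) :=
  int_bdd B (hF.comp (by fun_prop)).aestronglyMeasurable (fun z => hB _)

lemma heat_meas {F : E → ℝ} (hF : Measurable F) (t : ℝ) : Measurable (heat t F) := by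
  have : StronglyMeasurable (fun q : E × E => F (q.1 + √t • q.2)) :=
    (hF.comp (by fun_prop)).stronglyMeasurable
  exact this.integral_prod_right.measurable

lemma heat_le {F : E → ℝ} (hF : Measurable F) {α β : ℝ} (hα : ∀ x, α ≤ F x) (hβ : ∀ x, F x ≤ β) (t : ℝ) (x : E) :
    α ≤ heat t F x ∧ heat t F x ≤ β := by
  have i := heat_int hF (B := max |α| |β|) (fun x => abs_le_max_abs_abs (hα x) (hβ x)) t x
  unfold heat
  constructor
  · have := integral_mono (integrable_const α) i (fun z => hα _)
    simpa using this
  · have := integral_mono i (integrable_const β) (fun z => hβ _)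
    simpa using this

lemma heat_heat {F : E → ℝ} (hF : Measurable F) {B : ℝ} (hB : ∀ x, |F x| ≤ B) {s t : ℝ} (hs : 0 ≤ s) (ht : 0 ≤ t) :
    heat s (heat t F) = heat (s + t) F := by
  ext x
  have h := gauss_semi (E := E) s t hs ht
  have hm : Measurable fun y => F (x + y) := hF.comp (by fun_prop)
  have e1 : heat (s + t) F x = ∫ y, F (x + y) ∂((stdGaussian E).map (fun x => √(s + t) • x)) := by
    rw [integral_map (by fun_prop) hm.aestronglyMeasurable]; rfl
  rw [e1, ← h, integral_map (by fun_prop) hm.aestronglyMeasurable, integral_prod]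
  · unfold heat; simp_rw [add_assoc]
  · exact int_bdd B (hF.comp (by fun_prop)).aestronglyMeasurable (fun z => hB _)

end heat

section main
variable {ι : Type*} [Fintype ι] {E : Type*} [NormedAddCommGroup E] [InnerProductSpace ℝ E] [FiniteDimensional ℝ E]
  [MeasurableSpace E] [BorelSpace E]
variable {H : ι → Type*} [∀ i, NormedAddCommGroup (H i)] [∀ i, InnerProductSpace ℝ (H i)]
  [∀ i, FiniteDimensional ℝ (H i)] [∀ i, MeasurableSpace (H i)] [∀ i, BorelSpace (H i)]

/-- The summation map. -/
noncomputable def Sm (c : ι → ℝ) (V : ∀ i, E →L[ℝ] H i) (x : ∀ i, H i) : E :=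
  ∑ i, c i • (V i).adjoint (x i)

/-- Geometric Brascamp-Lieb datum. -/
structure Geo (c : ι → ℝ) (V : ∀ i, E →L[ℝ] H i) : Prop where
  pos : ∀ i, 0 < c i
  iso : ∀ i y, ‖(V i).adjoint y‖ = ‖y‖
  res : ∀ x, ∑ i, c i • (V i).adjoint (V i x) = x

variable {c : ι → ℝ} {V : ∀ i, E →L[ℝ] H i}

lemma Geo.sum_add (g : Geo c V) (x : ∀ i, H i) (y : E) : Sm c V (fun i => x i + V i y) = Sm c V x + y := by
  conv_rhs => rw [← g.res y]
  simp [Sm, smul_add, Finset.sum_add_distrib]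

lemma Sm_add (x y : ∀ i, H i) : Sm c V (fun i => x i + y i) = Sm c V x + Sm c V y := by
  simp [Sm, smul_add, Finset.sum_add_distrib]

lemma Sm_smul (r : ℝ) (x : ∀ i, H i) : Sm c V (fun i => r • x i) = r • Sm c V x := by
  simp [Sm, Finset.smul_sum, smul_comm r]

lemma Geo.norm_sq (g : Geo c V) (x : E) : ‖x‖ ^ 2 = ∑ i, c i * ‖V i x‖ ^ 2 := by
  rw [← real_inner_self_eq_norm_sq]
  nth_rewrite 1 [← g.res x]
  rw [sum_inner]
  congr 1; ext i
  rw [inner_smul_left, ContinuousLinearMap.adjoint_inner_left, real_inner_self_eq_norm_sq]; rfl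

lemma Geo.norm_Sm (g : Geo c V) (u : ∀ i, H i) : ‖Sm c V u‖ ^ 2 ≤ ∑ i, c i * ‖u i‖ ^ 2 := by
  set w := Sm c V u with hw
  have h1 : ‖w‖ ^ 2 = ∑ i, c i * ⟪u i, V i w⟫ := by
    rw [← real_inner_self_eq_norm_sq]
    nth_rewrite 1 [hw]
    rw [Sm, sum_inner]
    congr 1; ext i
    rw [inner_smul_left, ContinuousLinearMap.adjoint_inner_left]; rfl
  have h2 : ∑ i, c i * ⟪u i, V i w⟫ ≤ ∑ i, (c i * ‖u i‖ ^ 2 / 2 + c i * ‖V i w‖ ^ 2 / 2) := by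
    refine Finset.sum_le_sum fun i _ => ?_
    have a := real_inner_le_norm (u i) (V i w)
    have b := sq_nonneg (‖u i‖ - ‖V i w‖)
    have := g.pos i
    nlinarith [mul_le_mul_of_nonneg_left a this.le, mul_nonneg this.le b]
  rw [Finset.sum_add_distrib, ← Finset.sum_div, ← Finset.sum_div, ← g.norm_sq] at h2
  linarith

lemma Geo.step (g : Geo c V) {G : E → ℝ} (hG : Measurable G) {B : ℝ} (hB : ∀ x, |G x| ≤ B)
    {K : ℝ} {p : ∀ i, H i → ℝ} {a : ∀ i, H i → H i} (hp : ∀ i, Nice K (p i) (a i))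
    (hGp : ∀ x, ∑ i, c i * p i (x i) ≤ G (Sm c V x)) (C : ι → ℝ) (x : ∀ i, H i) (d : ℝ)
    (hC : ∀ i, Real.log (∫ z, Real.exp (p i (x i + d • z)) ∂(stdGaussian (H i))) - C i * d ^ 3 ≤
      ∫ z, p i (x i + d • z + d ^ 2 • a i (x i)) ∂(stdGaussian (H i)) - d ^ 2 * ‖a i (x i)‖ ^ 2 / 2) :
    ∑ i, c i * Real.log (∫ z, Real.exp (p i (x i + d • z)) ∂(stdGaussian (H i))) - (∑ i, c i * C i) * d ^ 3
      ≤ Real.log (∫ z, Real.exp (G (Sm c V x + d • z)) ∂(stdGaussian E)) := by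
  set u := Sm c V (fun i => a i (x i)) with hu
  have iG : Integrable (fun z => G (Sm c V x + d • z + d ^ 2 • u)) (stdGaussian E) :=
    int_bdd B (hG.comp (by fun_prop)).aestronglyMeasurable (fun z => hB _)
  have iE : Integrable (fun z => Real.exp (G (Sm c V x + d • z))) (stdGaussian E) :=
    int_bdd (Real.exp B) (Real.measurable_exp.comp (hG.comp (by fun_prop))).aestronglyMeasurable (fun z => by
      rw [Real.norm_eq_abs, abs_of_pos (Real.exp_pos _)]
      exact Real.exp_le_exp.2 ((le_abs_self _).trans (hB _)))
  have ip : ∀ i, Integrable (fun z => p i (x i + d • V i z + d ^ 2 • a i (x i))) (stdGaussian E) := fun i =>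
    int_bdd K (by have := (hp i).cont; fun_prop) (fun z => (hp i).bd _)
  -- lower bound for G
  have e : ∀ z : E, Real.exp (G (Sm c V x + d • (z + d • u))) * Real.exp (-⟪z, d • u⟫ - ‖d • u‖ ^ 2 / 2)
      = Real.exp (G (Sm c V x + d • z + d ^ 2 • u) - d * ⟪u, z⟫ - d ^ 2 * ‖u‖ ^ 2 / 2) := by
    intro z
    rw [← Real.exp_add, norm_smul, mul_pow, Real.norm_eq_abs, sq_abs, inner_smul_right, real_inner_comm,
      smul_add, smul_smul, ← add_assoc, ← sq]
    congr 1; ring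
  have s1 : ∫ z, Real.exp (G (Sm c V x + d • z)) ∂(stdGaussian E) =
      ∫ z, Real.exp (G (Sm c V x + d • z + d ^ 2 • u) - d * ⟪u, z⟫ - d ^ 2 * ‖u‖ ^ 2 / 2) ∂(stdGaussian E) := by
    rw [← gauss_shift _ (d • u)]
    simp_rw [e]
  have iL : Integrable (fun z => G (Sm c V x + d • z + d ^ 2 • u) - d * ⟪u, z⟫ - d ^ 2 * ‖u‖ ^ 2 / 2) (stdGaussian E) :=
    (iG.sub ((gauss_inner_integrable u).const_mul d)).sub (integrable_const _)
  have hpos : 0 < ∫ z, Real.exp (G (Sm c V x + d • z)) ∂(stdGaussian E) := integral_exp_pos iE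
  have iX : Integrable (fun z => Real.exp (G (Sm c V x + d • z + d ^ 2 • u) - d * ⟪u, z⟫ - d ^ 2 * ‖u‖ ^ 2 / 2)) (stdGaussian E) := by
    by_contra hcon
    rw [s1, integral_undef hcon] at hpos
    exact lt_irrefl _ hpos
  have J := (convexOn_exp).map_integral_le (μ := stdGaussian E) Real.continuous_exp.continuousOn isClosed_univ
    (f := fun z => G (Sm c V x + d • z + d ^ 2 • u) - d * ⟪u, z⟫ - d ^ 2 * ‖u‖ ^ 2 / 2)
    (Filter.Eventually.of_forall fun z => Set.mem_univ _) iL iX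
  rw [← s1, ← Real.le_log_iff_exp_le hpos] at J
  refine le_trans ?_ J
  have s2 : ∫ z, (G (Sm c V x + d • z + d ^ 2 • u) - d * ⟪u, z⟫ - d ^ 2 * ‖u‖ ^ 2 / 2) ∂(stdGaussian E) =
     (∫ z, G (Sm c V x + d • z + d ^ 2 • u) ∂(stdGaussian E)) - d ^ 2 * ‖u‖ ^ 2 / 2 := by
    rw [integral_sub (by exact iG.sub ((gauss_inner_integrable u).const_mul d)) (integrable_const _),
      integral_sub iG ((gauss_inner_integrable u).const_mul d), integral_const_mul, gauss_inner]
    simp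
  rw [s2]
  have pt : ∀ z : E, ∑ i, c i * p i (x i + d • V i z + d ^ 2 • a i (x i)) ≤ G (Sm c V x + d • z + d ^ 2 • u) := by
    intro z
    have := hGp (fun i => x i + d • V i z + d ^ 2 • a i (x i))
    rw [Sm_add, Sm_smul, ← hu] at this
    have q := g.sum_add x (d • z)
    simp only [map_smul] at q
    rwa [q] at this
  have s3 := integral_mono (integrable_finsetSum Finset.univ fun i _ => (ip i).const_mul (c i)) iG pt
  rw [integral_finsetSum _ fun i _ => (ip i).const_mul (c i)] at s3
  have s4 : ∀ i, ∫ z, p i (x i + d • V i z + d ^ 2 • a i (x i)) ∂(stdGaussian E) =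
      ∫ z, p i (x i + d • z + d ^ 2 • a i (x i)) ∂(stdGaussian (H i)) := by
    intro i
    have hc := (hp i).cont
    rw [← gauss_map (V i) (g.iso i), integral_map (by fun_prop) (by fun_prop)]
  simp_rw [integral_const_mul, s4] at s3
  have s5 := g.norm_Sm (fun i => a i (x i))
  rw [← hu] at s5
  have s6 : ∑ i, c i * (Real.log (∫ z, Real.exp (p i (x i + d • z)) ∂(stdGaussian (H i))) - C i * d ^ 3) ≤
      ∑ i, c i * (∫ z, p i (x i + d • z + d ^ 2 • a i (x i)) ∂(stdGaussian (H i)) - d ^ 2 * ‖a i (x i)‖ ^ 2 / 2) :=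
    Finset.sum_le_sum fun i _ => mul_le_mul_of_nonneg_left (hC i) (g.pos i).le
  simp only [mul_sub, Finset.sum_sub_distrib] at s6
  have s7 : ∑ i, c i * (d ^ 2 * ‖a i (x i)‖ ^ 2 / 2) = d ^ 2 / 2 * ∑ i, c i * ‖a i (x i)‖ ^ 2 := by
    rw [Finset.mul_sum]; congr 1; ext i; ring
  have s8 : ∑ i, c i * (C i * d ^ 3) = (∑ i, c i * C i) * d ^ 3 := by
    rw [Finset.sum_mul]; congr 1; ext i; ring
  rw [s7, s8] at s6
  have s9 := mul_le_mul_of_nonneg_left s5 (by positivity : 0 ≤ d ^ 2 / 2)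
  linarith

theorem Geo.flow (g : Geo c V) {F : E → ℝ} (hF : Measurable F) {α β : ℝ} (hα0 : 0 < α) (hα : ∀ x, α ≤ F x)
    (hβ : ∀ x, F x ≤ β) {K : ι → ℝ} {p : ∀ i, H i → ℝ} {a : ∀ i, H i → H i} (hp : ∀ i, Nice (K i) (p i) (a i))
    (hFp : ∀ x, Real.exp (∑ i, c i * p i (x i)) ≤ F (Sm c V x)) (t : ℝ) (ht : 0 ≤ t) (x : ∀ i, H i) :
    ∑ i, c i * Real.log (heat t (fun y => Real.exp (p i y)) (x i)) ≤ Real.log (heat t F (Sm c V x)) := by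
  choose K1 b1 h1 using fun i => (hp i).exp
  have hlow : ∀ i x, Real.exp (-K i) ≤ Real.exp (p i x) := fun i x =>
    Real.exp_le_exp.2 (abs_le.1 ((hp i).bd x)).1
  have hcont : ∀ i, Measurable (fun y => Real.exp (p i y)) := fun i => (h1 i).cont.measurable
  have hbnd : ∀ i x, |Real.exp (p i x)| ≤ K1 i := fun i => (h1 i).bd
  choose K2 h2 using fun i => Nice.log (E := H i) (K := K1 i) (Real.exp_pos (-K i))
  set K3 := ∑ i, |K2 i| with hK3
  have hK3' : ∀ i, K2 i ≤ K3 := fun i => (le_abs_self _).trans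
    (Finset.single_le_sum (f := fun i => |K2 i|) (fun i _ => abs_nonneg _) (Finset.mem_univ i))
  have hpos : ∀ i s y, 0 < heat s (fun y => Real.exp (p i y)) y := fun i s y =>
    (Real.exp_pos _).trans_le (heat_le (hcont i) (hlow i) (fun x => (le_abs_self _).trans (hbnd i x)) s y).1
  have h3 : ∀ i s, ∃ b, Nice K3 (fun y => Real.log (heat s (fun y => Real.exp (p i y)) y)) b := by
    intro i s
    obtain ⟨b, hb⟩ := h2 i ((h1 i).heat s)
      (fun y => (heat_le (hcont i) (hlow i) (fun x => (le_abs_self _).trans (hbnd i x)) s y).1)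
    exact ⟨b, hb.mono (hK3' i)⟩
  choose b hb using h3
  choose C hC0 hC using fun i => one_step (H i) K3
  have hFb : ∀ x, |F x| ≤ max |α| |β| := fun x => abs_le_max_abs_abs (hα x) (hβ x)
  have hFpos : ∀ s y, 0 < heat s F y := fun s y => hα0.trans_le (heat_le hF hα hβ s y).1
  set D := ∑ i, c i * C i with hD
  have iter : ∀ δ : ℝ, 0 ≤ δ → δ ≤ 1 → ∀ k : ℕ, ∀ x : ∀ i, H i,
      ∑ i, c i * Real.log (heat (k * δ) (fun y => Real.exp (p i y)) (x i)) - k * (D * √δ ^ 3) ≤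
        Real.log (heat (k * δ) F (Sm c V x)) := by
    intro δ hδ hδ1 k
    induction k with
    | zero =>
      intro x
      simp only [Nat.cast_zero, zero_mul, heat_zero, Real.log_exp, sub_zero]
      rw [Real.le_log_iff_exp_le (hα0.trans_le (hα _))]
      exact hFp x
    | succ k ih =>
      intro x
      have hkδ : 0 ≤ (k : ℝ) * δ := by positivity
      set G : E → ℝ := fun y => Real.log (heat (k * δ) F y) + k * (D * √δ ^ 3) with hGd
      have hGm : Measurable G := ((heat_meas hF _).log).add_const _
      have hGb : ∀ y, |G y| ≤ max |Real.log α| |Real.log β| + |k * (D * √δ ^ 3)| := by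
        intro y
        refine (abs_add_le _ _).trans ?_
        gcongr
        obtain ⟨q1, q2⟩ := heat_le hF hα hβ (k * δ) y
        exact abs_le_max_abs_abs (Real.log_le_log hα0 q1) (Real.log_le_log (hFpos _ _) q2)
      have st := g.step hGm hGb (fun i => hb i (k * δ)) (fun x => by have := ih x; simp only [hGd]; linarith) C x (√δ)
        (fun i => hC i (hb i (k * δ)) (x i) (√δ) (Real.sqrt_nonneg _) (Real.sqrt_le_one.2 hδ1))
      have e1 : ∀ i, ∫ z, Real.exp (Real.log (heat (k * δ) (fun y => Real.exp (p i y)) (x i + √δ • z))) ∂(stdGaussian (H i))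
          = heat ((k + 1 : ℕ) * δ) (fun y => Real.exp (p i y)) (x i) := by
        intro i
        simp_rw [Real.exp_log (hpos i _ _)]
        have := congrFun (heat_heat (hcont i) (hbnd i) hδ hkδ) (x i)
        rw [show ((k + 1 : ℕ) : ℝ) * δ = δ + k * δ by push_cast; ring, ← this]; rfl
      have e2 : ∫ z, Real.exp (G (Sm c V x + √δ • z)) ∂(stdGaussian E) =
          Real.exp (k * (D * √δ ^ 3)) * heat ((k + 1 : ℕ) * δ) F (Sm c V x) := by
        simp_rw [hGd, Real.exp_add, Real.exp_log (hFpos _ _)]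
        rw [integral_mul_const, mul_comm]
        have := congrFun (heat_heat hF hFb hδ hkδ) (Sm c V x)
        rw [show ((k + 1 : ℕ) : ℝ) * δ = δ + k * δ by push_cast; ring, ← this]; rfl
      simp_rw [e1] at st
      rw [e2, Real.log_mul (Real.exp_pos _).ne' (hFpos _ _).ne', Real.log_exp] at st
      push_cast at st ⊢
      linarith
  -- pass to the limit
  have lim : Filter.Tendsto (fun N : ℕ => ∑ i, c i * Real.log (heat t (fun y => Real.exp (p i y)) (x i)) - t * D * √(t / N))
      Filter.atTop (nhds (∑ i, c i * Real.log (heat t (fun y => Real.exp (p i y)) (x i)) - t * D * √0)) := by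
    refine tendsto_const_nhds.sub (Filter.Tendsto.const_mul _ ?_)
    exact (Real.continuous_sqrt.tendsto 0).comp (tendsto_const_div_atTop_nhds_zero_nat t)
  rw [Real.sqrt_zero, mul_zero, sub_zero] at lim
  refine le_of_tendsto lim ?_
  filter_upwards [Filter.eventually_ge_atTop (⌈t⌉₊ + 1)] with N hN
  have hN0 : (0 : ℝ) < N := by exact_mod_cast (by omega : 0 < N)
  have hNt : t ≤ N := (Nat.le_ceil t).trans (by exact_mod_cast (by omega : ⌈t⌉₊ ≤ N))
  have := iter (t / N) (by positivity) (by rw [div_le_one hN0]; exact hNt) N x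
  have e : (N : ℝ) * (t / N) = t := by field_simp
  have e3 : (N : ℝ) * (D * √(t / N) ^ 3) = t * D * √(t / N) := by
    rw [pow_succ, Real.sq_sqrt (by positivity)]; field_simp
  rw [e, e3] at this
  exact this

end main
end Barthe
end part3

section part4
open MeasureTheory ProbabilityTheory
open scoped ENNReal RealInnerProductSpace
set_option linter.unusedSectionVars false
set_option linter.unusedVariables false
namespace Barthe
section smooth
variable {E : Type*} [NormedAddCommGroup E] [InnerProductSpace ℝ E] [FiniteDimensional ℝ E]
  [MeasurableSpace E] [BorelSpace E]

lemma Nice.of_ty {M K : ℝ} {p : E → ℝ} {a : E → E} (hM : 0 ≤ M) (hK : 0 ≤ K) (bd : ∀ x, |p x| ≤ M)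
    (ty : ∀ x v, ‖v‖ ≤ 1 → |p (x + v) - p x - ⟪a x, v⟫| ≤ K * ‖v‖ ^ 2) : ∃ K', Nice K' p a := by
  have ab : ∀ x, ‖a x‖ ≤ 2 * M + K := by
    intro x
    by_cases h : a x = 0
    · rw [h]; simp; positivity
    have h' : ‖a x‖ ≠ 0 := norm_ne_zero_iff.2 h
    have hn : ‖‖a x‖⁻¹ • a x‖ = 1 := by rw [norm_smul, norm_inv, norm_norm, inv_mul_cancel₀ h']
    have := ty x (‖a x‖⁻¹ • a x) hn.le
    rw [hn, inner_smul_right, real_inner_self_eq_norm_sq, sq, ← mul_assoc, inv_mul_cancel₀ h', one_mul] at this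
    have b1 := abs_le.1 (bd x)
    have b2 := abs_le.1 (bd (x + ‖a x‖⁻¹ • a x))
    have b3 := abs_le.1 this
    linarith
  have ty2 : ∀ x v, |p (x + v) - p x - ⟪a x, v⟫| ≤ (4 * M + K) * ‖v‖ ^ 2 := by
    intro x v
    rcases le_total ‖v‖ 1 with h | h
    · refine (ty x v h).trans ?_
      nlinarith [sq_nonneg ‖v‖]
    · have b1 := abs_le.1 (bd x)
      have b2 := abs_le.1 (bd (x + v))
      have b4 := abs_le.1 (abs_real_inner_le_norm (a x) v)
      have b5 : ‖a x‖ * ‖v‖ ≤ (2 * M + K) * ‖v‖ := by gcongr; exact ab x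
      have b6 : ‖v‖ ≤ ‖v‖ ^ 2 := by nlinarith
      have b7 : (2 * M + K) * ‖v‖ ≤ (2 * M + K) * ‖v‖ ^ 2 := by gcongr
      have b8 : 2 * M * 1 ≤ 2 * M * ‖v‖ ^ 2 := by gcongr; linarith
      rw [abs_le]
      constructor <;> linarith
  have al : ∀ x y, ‖a x - a y‖ ≤ 6 * (4 * M + K) * ‖x - y‖ := by
    intro x y
    by_cases h : a x - a y = 0
    · rw [h]; simp; positivity
    have h' : ‖a x - a y‖ ≠ 0 := norm_ne_zero_iff.2 h
    by_cases hxy : x = y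
    · subst hxy; simp
    have hd : 0 < ‖x - y‖ := norm_pos_iff.2 (sub_ne_zero.2 hxy)
    set w := ‖a x - a y‖⁻¹ • (a x - a y) with hw
    have hn : ‖w‖ = 1 := by rw [hw, norm_smul, norm_inv, norm_norm, inv_mul_cancel₀ h']
    set v := ‖x - y‖ • w with hv
    have hvn : ‖v‖ = ‖x - y‖ := by rw [hv, norm_smul, hn]; simp
    set u := x - y with hu
    have e1 := abs_le.1 (ty2 x v)
    have e2 := abs_le.1 (ty2 y (u + v))
    have e3 := abs_le.1 (ty2 y u)
    have e4 : y + (u + v) = x + v := by rw [hu]; abel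
    have e5 : y + u = x := by rw [hu]; abel
    rw [e4, inner_add_right] at e2
    rw [e5] at e3
    have e6 : ‖u + v‖ ^ 2 ≤ 4 * ‖u‖ ^ 2 := by
      have := norm_add_le u v
      rw [hvn] at this
      nlinarith [norm_nonneg (u + v), norm_nonneg u]
    have e7 : ⟪a x, v⟫ - ⟪a y, v⟫ = ‖u‖ * ‖a x - a y‖ := by
      rw [← inner_sub_left, hv, hw, inner_smul_right, inner_smul_right, real_inner_self_eq_norm_sq]
      field_simp
    have e8 : (4 * M + K) * ‖u + v‖ ^ 2 ≤ (4 * M + K) * (4 * ‖u‖ ^ 2) := by gcongr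
    rw [hvn] at e1
    have e9 : ‖u‖ * ‖a x - a y‖ ≤ ‖u‖ * (6 * (4 * M + K) * ‖u‖) := by nlinarith
    exact le_of_mul_le_mul_left e9 hd
  have lip : ∀ x y, |p x - p y| ≤ 6 * (4 * M + K) * ‖x - y‖ := by
    intro x y
    have b1 := abs_le.1 (bd x)
    have b2 := abs_le.1 (bd y)
    rcases le_total ‖x - y‖ 1 with h | h
    · have e3 := abs_le.1 (ty2 y (x - y))
      rw [add_sub_cancel] at e3
      have b4 := abs_le.1 (abs_real_inner_le_norm (a y) (x - y))
      have b5 : ‖a y‖ * ‖x - y‖ ≤ (2 * M + K) * ‖x - y‖ := by gcongr; exact ab y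
      have b6 : ‖x - y‖ ^ 2 ≤ ‖x - y‖ := by nlinarith [norm_nonneg (x - y)]
      have b7 : (4 * M + K) * ‖x - y‖ ^ 2 ≤ (4 * M + K) * ‖x - y‖ := by gcongr
      have b8 : 0 ≤ (M + K) * ‖x - y‖ := by positivity
      rw [abs_le]
      constructor <;> nlinarith [mul_nonneg hM (norm_nonneg (x - y)), mul_nonneg hK (norm_nonneg (x - y))]
    · rw [abs_le]
      have b8 : M * 1 ≤ M * ‖x - y‖ := by gcongr
      constructor <;> nlinarith [mul_nonneg hM (norm_nonneg (x - y)), mul_nonneg hK (norm_nonneg (x - y))]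
  refine ⟨6 * (4 * M + K), fun x => (bd x).trans (by linarith), fun x => (ab x).trans (by linarith), al, lip,
    fun x v => (ty2 x v).trans ?_⟩
  gcongr
  linarith

lemma gauss_exp (b : ℝ) : Integrable (fun x : E => Real.exp (b * ‖x‖)) (stdGaussian E) := by
  obtain ⟨C, hC, h⟩ := IsGaussian.exists_integrable_exp_sq (stdGaussian E)
  refine (h.const_mul (Real.exp (b ^ 2 / (4 * C)))).mono' (by fun_prop) (Filter.Eventually.of_forall fun x => ?_)
  rw [Real.norm_eq_abs, abs_of_pos (Real.exp_pos _), ← Real.exp_add]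
  apply Real.exp_le_exp.2
  have : b ^ 2 / (4 * C) + C * ‖x‖ ^ 2 - b * ‖x‖ = (b - 2 * C * ‖x‖) ^ 2 / (4 * C) := by
    field_simp; ring
  have h2 : 0 ≤ (b - 2 * C * ‖x‖) ^ 2 / (4 * C) := by positivity
  linarith

lemma gauss_shift' (G : E → ℝ) (w : E) :
    ∫ z, G (z + w) ∂(stdGaussian E) = ∫ z, G z * Real.exp (⟪z, w⟫ - ‖w‖ ^ 2 / 2) ∂(stdGaussian E) := by
  rw [← gauss_shift (fun z => G z * Real.exp (⟪z, w⟫ - ‖w‖ ^ 2 / 2)) w]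
  congr 1; ext z
  rw [mul_assoc, ← Real.exp_add, inner_add_left, real_inner_self_eq_norm_sq]
  ring_nf
  simp

lemma exp_pt {s q : ℝ} (hq0 : 0 ≤ q) {b : ℝ} (hs : |s| ≤ q * b) (hq : q ≤ 1) (hb : 0 ≤ b) :
    |Real.exp (s - q ^ 2 / 2) - 1 - s| ≤ q ^ 2 * (3 * Real.exp (3 * b)) := by
  have hsb : |s| ≤ b := hs.trans (by nlinarith)
  have hsl := abs_le.1 hsb
  -- first: |e^s - 1 - s| ≤ s^2 e^|s|
  have h1 : |Real.exp s - 1 - s| ≤ s ^ 2 * Real.exp b := by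
    have l1 := Real.add_one_le_exp s
    have l2 := exp_sub_le 0 s
    simp only [Real.exp_zero, sub_zero] at l2
    have l3 : (Real.exp s - 1) * s ≤ s ^ 2 * Real.exp b := by
      have := exp_lip (K := b) (r := 0) (s := s) (by simpa using hb) hsb
      simp only [Real.exp_zero, sub_zero] at this
      calc (Real.exp s - 1) * s ≤ |(Real.exp s - 1) * s| := le_abs_self _
        _ = |Real.exp s - 1| * |s| := abs_mul _ _
        _ ≤ (Real.exp b * |s|) * |s| := by gcongr
        _ = s ^ 2 * Real.exp b := by rw [mul_assoc, abs_mul_abs_self]; ring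
    rw [abs_le]; constructor <;> nlinarith [Real.exp_pos b, sq_nonneg s]
  have h2 : |Real.exp (s - q ^ 2 / 2) - Real.exp s| ≤ Real.exp b * (q ^ 2 / 2) := by
    have l1 := exp_sub_le (s - q ^ 2 / 2) s
    have l2 : Real.exp (s - q ^ 2 / 2) ≤ Real.exp s := Real.exp_le_exp.2 (by nlinarith)
    have l3 : Real.exp s ≤ Real.exp b := Real.exp_le_exp.2 hsl.2
    rw [abs_le]; constructor <;> nlinarith [Real.exp_pos b, sq_nonneg q]
  have h3 : s ^ 2 ≤ q ^ 2 * b ^ 2 := by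
    rw [← mul_pow, ← sq_abs]; gcongr
  have h4 : b ^ 2 ≤ Real.exp (2 * b) := by
    have := Real.add_one_le_exp b
    have h : Real.exp (2 * b) = Real.exp b ^ 2 := by rw [← Real.exp_nat_mul]; norm_num
    rw [h]; gcongr; linarith
  have h5 : Real.exp (3 * b) = Real.exp (2 * b) * Real.exp b := by rw [← Real.exp_add]; ring_nf
  have h6 : Real.exp b ≤ Real.exp (3 * b) := Real.exp_le_exp.2 (by linarith)
  calc _ = |(Real.exp (s - q ^ 2 / 2) - Real.exp s) + (Real.exp s - 1 - s)| := by ring_nf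
    _ ≤ _ := abs_add_le _ _
    _ ≤ Real.exp b * (q ^ 2 / 2) + s ^ 2 * Real.exp b := add_le_add h2 h1
    _ ≤ Real.exp b * (q ^ 2 / 2) + q ^ 2 * Real.exp (2 * b) * Real.exp b := by gcongr; nlinarith [sq_nonneg q]
    _ ≤ q ^ 2 * (3 * Real.exp (3 * b)) := by
      rw [h5] at h6 ⊢
      nlinarith [sq_nonneg q, mul_nonneg (sq_nonneg q) (Real.exp_pos b).le, mul_le_mul_of_nonneg_left h6 (sq_nonneg q)]

lemma nice_heat {ψ : E → ℝ} (hψ : Measurable ψ) {M : ℝ} (hM : ∀ x, |ψ x| ≤ M) {r : ℝ} (hr : 0 < r) :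
    ∃ K a, Nice K (heat r ψ) a := by
  have hM0 : 0 ≤ M := (abs_nonneg _).trans (hM 0)
  -- smoothing with scale one, then rescale
  set s := √r with hs
  have hs0 : 0 < s := Real.sqrt_pos.2 hr
  set a : E → E := fun x => s⁻¹ • ∫ z, ψ (x + s • z) • z ∂(stdGaussian E) with ha
  set C := ∫ z : E, 3 * Real.exp (3 * ‖z‖) ∂(stdGaussian E) with hC
  have hC0 : 0 ≤ C := integral_nonneg fun z => by positivity
  have iE : Integrable (fun z : E => 3 * Real.exp (3 * ‖z‖)) (stdGaussian E) := (gauss_exp 3).const_mul 3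
  have mψ : ∀ x, Measurable fun z => ψ (x + s • z) := fun x => hψ.comp (by fun_prop)
  have iz : ∀ x, Integrable (fun z => ψ (x + s • z) • z) (stdGaussian E) := by
    intro x
    refine ((gauss_mom (E := E) 1).const_mul M).mono' ((mψ x).aestronglyMeasurable.smul (by fun_prop)) (Filter.Eventually.of_forall fun z => ?_)
    rw [norm_smul, pow_one]; gcongr; exact hM _
  have bd : ∀ x, |heat r ψ x| ≤ M := fun x => by
    unfold heat; rw [← Real.norm_eq_abs]; exact norm_int_le M fun z => hM _
  -- small w estimate
  have key : ∀ x w, ‖w‖ ≤ 1 → |heat r ψ (x + s • w) - heat r ψ x - ⟪a x, s • w⟫| ≤ M * C * ‖w‖ ^ 2 := by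
    intro x w hw
    have e1 : heat r ψ (x + s • w) = ∫ z, ψ (x + s • z) * Real.exp (⟪z, w⟫ - ‖w‖ ^ 2 / 2) ∂(stdGaussian E) := by
      rw [← gauss_shift' (fun z => ψ (x + s • z)) w]
      unfold heat
      congr 1; ext z; rw [smul_add]; congr 1; rw [← hs]; abel
    have e2 : ⟪a x, s • w⟫ = ∫ z, ψ (x + s • z) * ⟪z, w⟫ ∂(stdGaussian E) := by
      rw [ha, inner_smul_left, inner_smul_right, ← mul_assoc]
      simp only [conj_trivial]
      rw [inv_mul_cancel₀ hs0.ne', one_mul, real_inner_comm, ← integral_inner (iz x)]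
      congr 1; ext z; rw [inner_smul_right, real_inner_comm]
    have pt : ∀ z : E, |Real.exp (⟪z, w⟫ - ‖w‖ ^ 2 / 2) - 1 - ⟪z, w⟫| ≤ ‖w‖ ^ 2 * (3 * Real.exp (3 * ‖z‖)) := fun z =>
      exp_pt (norm_nonneg w) (by rw [mul_comm]; exact abs_real_inner_le_norm z w) hw (norm_nonneg z)
    have i2 : Integrable (fun z => ψ (x + s • z) * ⟪z, w⟫) (stdGaussian E) := by
      have := Integrable.inner_const (𝕜 := ℝ) (iz x) w
      refine this.congr (Filter.Eventually.of_forall fun z => ?_)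
      simp [inner_smul_left]
    have i1 : Integrable (fun z => ψ (x + s • z)) (stdGaussian E) := int_bdd M (mψ x).aestronglyMeasurable (fun z => hM _)
    have i3 : Integrable (fun z => ψ (x + s • z) * (Real.exp (⟪z, w⟫ - ‖w‖ ^ 2 / 2) - 1 - ⟪z, w⟫)) (stdGaussian E) := by
      refine (iE.const_mul (M * ‖w‖ ^ 2)).mono' ((mψ x).aestronglyMeasurable.mul (by fun_prop)) (Filter.Eventually.of_forall fun z => ?_)
      rw [norm_mul, mul_assoc]
      exact mul_le_mul (hM _) (pt z) (norm_nonneg _) hM0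
    have i4 : Integrable (fun z => ψ (x + s • z) * Real.exp (⟪z, w⟫ - ‖w‖ ^ 2 / 2)) (stdGaussian E) := by
      refine ((i3.add i1).add i2).congr (Filter.Eventually.of_forall fun z => ?_)
      simp only [Pi.add_apply]; ring
    have e3 : heat r ψ (x + s • w) - heat r ψ x - ⟪a x, s • w⟫ =
        ∫ z, ψ (x + s • z) * (Real.exp (⟪z, w⟫ - ‖w‖ ^ 2 / 2) - 1 - ⟪z, w⟫) ∂(stdGaussian E) := by
      rw [e1, e2]
      unfold heat
      have q1 := integral_sub i4 i1
      have q2 := integral_sub (i4.sub i1) i2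
      simp only [Pi.sub_apply] at q2
      rw [← hs, ← q1, ← q2]
      congr 1; ext z; ring
    rw [e3, ← Real.norm_eq_abs]
    refine (norm_integral_le_of_norm_le (iE.const_mul (M * ‖w‖ ^ 2)) (Filter.Eventually.of_forall fun z => ?_)).trans ?_
    · rw [norm_mul, mul_assoc]
      exact mul_le_mul (hM _) (pt z) (norm_nonneg _) hM0
    · rw [integral_const_mul, ← hC]; nlinarith
  -- a bound
  set D := ∫ z : E, M * ‖z‖ ^ 1 ∂(stdGaussian E) with hD
  have hD0 : 0 ≤ D := integral_nonneg fun z => by positivity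
  have hab : ∀ x, ‖a x‖ ≤ s⁻¹ * D := by
    intro x
    rw [ha, norm_smul, norm_inv, Real.norm_of_nonneg hs0.le]
    gcongr
    refine norm_integral_le_of_norm_le ((gauss_mom (E := E) 1).const_mul M) (Filter.Eventually.of_forall fun z => ?_)
    rw [norm_smul, pow_one]; gcongr; exact hM _
  have fin : ∃ K', Nice K' (heat r ψ) a := by
    refine Nice.of_ty (M := M) (K := M * C * s⁻¹ ^ 2 + (2 * M * s⁻¹ ^ 2 + s⁻¹ ^ 2 * D)) hM0 (by positivity) bd ?_
    intro x v hv
    have hvs : v = s • (s⁻¹ • v) := by rw [smul_smul, mul_inv_cancel₀ hs0.ne', one_smul]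
    set w := s⁻¹ • v with hw
    have hwn : ‖w‖ = s⁻¹ * ‖v‖ := by rw [hw, norm_smul, norm_inv, Real.norm_of_nonneg hs0.le]
    rcases le_total ‖w‖ 1 with h | h
    · have := key x w h
      rw [← hvs, hwn] at this
      refine this.trans ?_
      have : 0 ≤ (2 * M * s⁻¹ ^ 2 + s⁻¹ ^ 2 * D) * ‖v‖ ^ 2 := by positivity
      nlinarith
    · have b1 := abs_le.1 (bd x)
      have b2 := abs_le.1 (bd (x + v))
      have b3 := abs_le.1 (abs_real_inner_le_norm (a x) v)
      have b4 : ‖a x‖ * ‖v‖ ≤ (s⁻¹ * D) * ‖v‖ := by gcongr; exact hab x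
      rw [hwn] at h
      have b5 : 2 * M * 1 ≤ 2 * M * (s⁻¹ * ‖v‖) ^ 2 := by gcongr; nlinarith
      have b6 : D * (s⁻¹ * ‖v‖) ≤ D * (s⁻¹ * ‖v‖) ^ 2 := by gcongr; nlinarith
      have b7 : 0 ≤ M * C * s⁻¹ ^ 2 * ‖v‖ ^ 2 := by positivity
      rw [abs_le]
      constructor <;> nlinarith
  obtain ⟨K, hK⟩ := fin
  exact ⟨K, a, hK⟩

end smooth
end Barthe
end part4

section part5
open MeasureTheory ProbabilityTheory
open scoped ENNReal RealInnerProductSpace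
set_option linter.unusedSectionVars false
set_option linter.unusedVariables false
namespace Barthe
section decay
variable {E : Type*} [NormedAddCommGroup E] [InnerProductSpace ℝ E] [FiniteDimensional ℝ E]
  [MeasurableSpace E] [BorelSpace E]

/-- heat kernel normalization -/
noncomputable def ck (E : Type*) [NormedAddCommGroup E] [InnerProductSpace ℝ E] (t : ℝ) : ℝ :=
  (2 * Real.pi * t) ^ (-(Module.finrank ℝ E : ℝ) / 2)

lemma ck_pos {t : ℝ} (ht : 0 < t) : 0 < ck E t := by unfold ck; positivity

lemma ck_eq {t : ℝ} (ht : 0 < t) : ck E t =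
    (√t ^ Module.finrank ℝ E)⁻¹ * (2 * Real.pi) ^ (-(Module.finrank ℝ E : ℝ) / 2) := by
  unfold ck
  rw [Real.mul_rpow (by positivity) ht.le, mul_comm]
  congr 1
  rw [Real.sqrt_eq_rpow, ← Real.rpow_natCast, ← Real.rpow_mul ht.le, ← Real.rpow_neg ht.le]
  ring_nf

lemma heat_eq (q : E → ℝ) {t : ℝ} (ht : 0 < t) (x : E) :
    heat t q x = ck E t * ∫ y, Real.exp (-‖y‖ ^ 2 / (2 * t)) * q (x + y) := by
  have hs : 0 < √t := Real.sqrt_pos.2 ht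
  have := Measure.integral_comp_smul_of_nonneg volume (fun y : E => dens E ((√t)⁻¹ • y) * q (x + y)) (√t) (hR := hs.le)
  unfold heat
  rw [integral_gauss]
  simp only [smul_smul, inv_mul_cancel₀ hs.ne', one_smul] at this
  rw [this, ck_eq ht, smul_eq_mul, mul_assoc,
    ← integral_const_mul ((2 * Real.pi) ^ (-(Module.finrank ℝ E : ℝ) / 2))]
  congr 1
  refine integral_congr_ae (Filter.Eventually.of_forall fun y => ?_)
  simp only
  unfold dens
  rw [norm_smul, norm_inv, Real.norm_of_nonneg hs.le, mul_pow, inv_pow, Real.sq_sqrt ht.le, mul_assoc]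
  congr 3
  field_simp

lemma heat_abs_le {q : E → ℝ} (hq : Integrable q) {t : ℝ} (ht : 0 < t) (x : E) :
    |heat t q x| ≤ ck E t * ∫ y, |q y| := by
  rw [heat_eq q ht, abs_mul, abs_of_pos (ck_pos ht)]
  apply mul_le_mul_of_nonneg_left _ (ck_pos ht).le
  rw [← integral_add_left_eq_self (fun y => |q y|) x, ← Real.norm_eq_abs]
  refine norm_integral_le_of_norm_le ((hq.abs).comp_add_left x) (Filter.Eventually.of_forall fun y => ?_)
  rw [norm_mul, Real.norm_of_nonneg (Real.exp_pos _).le, Real.norm_eq_abs]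
  have : Real.exp (-‖y‖ ^ 2 / (2 * t)) ≤ 1 := by
    apply Real.exp_le_one_iff.2
    rw [neg_div]; simp only [Left.neg_nonpos_iff]; positivity
  nlinarith [abs_nonneg (q (x + y))]

lemma heat_enorm_le {q : E → ℝ} (hq : Measurable q) {t : ℝ} (ht : 0 < t) (x : E) :
    ‖heat t q x‖ₑ ≤ ENNReal.ofReal (ck E t) * ∫⁻ y, ‖q y‖ₑ := by
  by_cases h : ∫⁻ y, ‖q y‖ₑ = ∞
  · rw [h, ENNReal.mul_top]
    · exact le_top
    · simpa using ck_pos ht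
  have hi : Integrable q := ⟨hq.aestronglyMeasurable, lt_top_iff_ne_top.2 h⟩
  have := heat_abs_le hi ht x
  rw [← ofReal_integral_norm_eq_lintegral_enorm hi, ← ENNReal.ofReal_mul (ck_pos ht).le, ← ofReal_norm]
  exact ENNReal.ofReal_le_ofReal this

lemma heat_lower {q : E → ℝ} (hq : Integrable q) (hq0 : ∀ x, 0 ≤ q x) {R : ℝ} (hR : ∀ x, R < ‖x‖ → q x = 0)
    {t : ℝ} (ht : 0 < t) :
    ck E t * (Real.exp (-R ^ 2 / (2 * t)) * ∫ y, q y) ≤ heat t q 0 := by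
  rw [heat_eq q ht]
  apply mul_le_mul_of_nonneg_left _ (ck_pos ht).le
  simp only [zero_add]
  rw [← integral_const_mul]
  apply integral_mono (hq.const_mul _)
  · refine hq.mono' (AEStronglyMeasurable.mul (by fun_prop) hq.1) (Filter.Eventually.of_forall fun y => ?_)
    rw [norm_mul, Real.norm_of_nonneg (Real.exp_pos _).le, Real.norm_of_nonneg (hq0 y)]
    have : Real.exp (-‖y‖ ^ 2 / (2 * t)) ≤ 1 := by
      apply Real.exp_le_one_iff.2
      rw [neg_div]; simp only [Left.neg_nonpos_iff]; positivity
    nlinarith [hq0 y]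
  · intro y
    rcases lt_or_ge R ‖y‖ with h | h
    · simp [hR y h]
    · have : 0 ≤ q y := hq0 y
      have h0 := norm_nonneg y
      simp only [neg_div]
      gcongr

lemma trans_cont {φ : E → ℝ} (hφ : Integrable φ) :
    Filter.Tendsto (fun w : E => ∫⁻ x, ‖φ (x + w) - φ x‖ₑ) (nhds 0) (nhds 0) := by
  have hm : MemLp φ 1 (volume : Measure E) := memLp_one_iff_integrable.2 hφ
  let T : E → C(E, E) := fun w => ⟨fun x => x + w, by fun_prop⟩
  have hT : Filter.Tendsto T (nhds 0) (nhds (T 0)) := by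
    have : Continuous T := ContinuousMap.continuous_of_continuous_uncurry _ (by
      change Continuous (fun p : E × E => p.2 + p.1); fun_prop)
    exact this.tendsto 0
  have mp : ∀ w, MeasurePreserving (T w) (volume : Measure E) volume := fun w => measurePreserving_add_right volume w
  have := Filter.Tendsto.compMeasurePreservingLp (l := nhds (0 : E)) (f := fun _ => hm.toLp φ) (f₀ := hm.toLp φ)
    (g := T) (g₀ := T 0) tendsto_const_nhds hT mp (mp 0) (by simp)
  rw [tendsto_iff_edist_tendsto_0] at this
  refine this.congr fun w => ?_
  rw [Lp.toLp_compMeasurePreserving, Lp.toLp_compMeasurePreserving, Lp.edist_toLp_toLp, eLpNorm_one_eq_lintegral_enorm]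
  simp [T]

lemma heat_L1 {φ : E → ℝ} (hφm : Measurable φ) (hφ : Integrable φ) {M : ℝ} (hM : ∀ x, |φ x| ≤ M) :
    Filter.Tendsto (fun r : ℝ => ∫⁻ x, ‖heat r φ x - φ x‖ₑ) (nhdsWithin 0 (Set.Ioi 0)) (nhds 0) := by
  set T : E → ℝ≥0∞ := fun w => ∫⁻ x, ‖φ (x + w) - φ x‖ₑ with hT
  have mT : Measurable T := by
    have : Measurable (fun q : E × E => ‖φ (q.2 + q.1) - φ q.2‖ₑ) := by fun_prop
    exact this.lintegral_prod_right'
  have hb : ∀ w, T w ≤ 2 * ∫⁻ x, ‖φ x‖ₑ := by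
    intro w
    calc T w ≤ ∫⁻ x, (‖φ (x + w)‖ₑ + ‖φ x‖ₑ) := lintegral_mono fun x => enorm_sub_le
      _ = (∫⁻ x, ‖φ (x + w)‖ₑ) + ∫⁻ x, ‖φ x‖ₑ := lintegral_add_right _ (by fun_prop)
      _ = _ := by rw [lintegral_add_right_eq_self (fun x => ‖φ x‖ₑ) w]; ring
  have lim : Filter.Tendsto (fun r : ℝ => ∫⁻ z, T (√r • z) ∂(stdGaussian E)) (nhdsWithin 0 (Set.Ioi 0))
      (nhds (∫⁻ z : E, 0 ∂(stdGaussian E))) := by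
    refine tendsto_lintegral_filter_of_dominated_convergence (fun _ => 2 * ∫⁻ x, ‖φ x‖ₑ) ?_ ?_ ?_ ?_
    · exact Filter.Eventually.of_forall fun r => mT.comp (by fun_prop)
    · exact Filter.Eventually.of_forall fun r => Filter.Eventually.of_forall fun z => hb _
    · simp only [lintegral_const, measure_univ, mul_one]
      exact ENNReal.mul_ne_top (by simp) hφ.2.ne
    · refine Filter.Eventually.of_forall fun z => ?_
      refine (trans_cont hφ).comp ?_
      have : Continuous (fun r : ℝ => √r • z) := by fun_prop
      have := this.tendsto 0
      simp only [Real.sqrt_zero, zero_smul] at this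
      exact this.mono_left nhdsWithin_le_nhds
  simp only [lintegral_zero] at lim
  refine tendsto_of_tendsto_of_tendsto_of_le_of_le tendsto_const_nhds lim (fun _ => zero_le) fun r => ?_
  change ∫⁻ x, ‖heat r φ x - φ x‖ₑ ≤ ∫⁻ z, T (√r • z) ∂(stdGaussian E)
  calc ∫⁻ x, ‖heat r φ x - φ x‖ₑ ≤ ∫⁻ x, ∫⁻ z, ‖φ (x + √r • z) - φ x‖ₑ ∂(stdGaussian E) := by
        refine lintegral_mono fun x => ?_
        have : heat r φ x - φ x = ∫ z, (φ (x + √r • z) - φ x) ∂(stdGaussian E) := by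
          rw [integral_sub (heat_int hφm hM r x) (integrable_const _)]
          simp [heat]
        simp only [this]
        exact enorm_integral_le_lintegral_enorm _
    _ = _ := by
      rw [lintegral_lintegral_swap]
      have : Measurable (fun q : E × E => ‖φ (q.1 + √r • q.2) - φ q.1‖ₑ) := by fun_prop
      exact this.aemeasurable

lemma heat_sub {p q : E → ℝ} {M : ℝ} (hp : Measurable p) (hq : Measurable q) (hpM : ∀ x, |p x| ≤ M) (hqM : ∀ x, |q x| ≤ M)
    (t : ℝ) (x : E) : heat t (fun y => p y - q y) x = heat t p x - heat t q x :=
  integral_sub (heat_int hp hpM t x) (heat_int hq hqM t x)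

lemma heat_const (k t : ℝ) (x : E) : heat t (fun _ => k) x = k := by simp [heat]

lemma heat_exp_lim {ψ : E → ℝ} (hψ : Measurable ψ) {M k : ℝ} (hM : ∀ x, |ψ x| ≤ M)
    (hφ : Integrable (fun x => ψ x - k)) {t : ℝ} (ht : 0 < t) :
    Filter.Tendsto (fun r : ℝ => heat t (fun y => Real.exp (heat r ψ y)) 0) (nhdsWithin 0 (Set.Ioi 0))
      (nhds (heat t (fun y => Real.exp (ψ y)) 0)) := by
  rw [tendsto_iff_edist_tendsto_0]
  have L := heat_L1 (φ := fun x => ψ x - k) (hψ.sub_const k) hφ (M := M + |k|)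
    (fun x => (abs_sub _ _).trans (by linarith [hM x]))
  have L2 := ENNReal.Tendsto.const_mul (a := ENNReal.ofReal (ck E t) * ENNReal.ofReal (Real.exp M)) L
    (Or.inr (ENNReal.mul_ne_top (by simp) (by simp)))
  rw [mul_zero] at L2
  refine tendsto_of_tendsto_of_tendsto_of_le_of_le tendsto_const_nhds L2 (fun _ => zero_le) fun r => ?_
  have hb : ∀ x, |heat r ψ x| ≤ M := fun x => by
    have := heat_le hψ (fun x => (abs_le.1 (hM x)).1) (fun x => (abs_le.1 (hM x)).2) r x
    exact abs_le.2 this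
  have hm := heat_meas hψ r
  have eb : ∀ s, |s| ≤ M → |Real.exp s| ≤ Real.exp M := fun s hs => by
    rw [abs_of_pos (Real.exp_pos _)]; exact Real.exp_le_exp.2 (abs_le.1 hs).2
  simp only [edist_eq_enorm_sub]
  rw [← heat_sub (M := Real.exp M) (by fun_prop) (by fun_prop) (fun x => eb _ (hb x)) (fun x => eb _ (hM x))]
  refine (heat_enorm_le (by fun_prop) ht 0).trans ?_
  rw [mul_assoc]
  gcongr
  rw [← lintegral_const_mul _ (by have := heat_meas (hψ.sub_const k) r; fun_prop)]
  refine lintegral_mono fun y => ?_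
  have e1 : heat r (fun x => ψ x - k) y = heat r ψ y - k := by
    rw [heat_sub (q := fun _ => k) (M := M + |k|) hψ (by fun_prop) (fun x => (hM x).trans (by simp))
      (fun x => by have := (abs_nonneg _).trans (hM 0); linarith), heat_const]
  simp only [e1]
  rw [← ofReal_norm, ← ofReal_norm, ← ENNReal.ofReal_mul (Real.exp_pos _).le]
  apply ENNReal.ofReal_le_ofReal
  have := exp_lip (hM y) (hb y)
  rw [Real.norm_eq_abs, Real.norm_eq_abs]
  convert this using 3
  ring

end decay
end Barthe
end part5

section part6
open MeasureTheory ProbabilityTheory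
open scoped ENNReal RealInnerProductSpace
set_option linter.unusedSectionVars false
set_option linter.unusedVariables false
namespace Barthe
section bdd
variable {ι : Type*} [Fintype ι] {E : Type*} [NormedAddCommGroup E] [InnerProductSpace ℝ E] [FiniteDimensional ℝ E]
  [MeasurableSpace E] [BorelSpace E] {H : ι → Type*} [∀ i, NormedAddCommGroup (H i)]
  [∀ i, InnerProductSpace ℝ (H i)] [∀ i, FiniteDimensional ℝ (H i)]
  [∀ i, MeasurableSpace (H i)] [∀ i, BorelSpace (H i)]
variable {c : ι → ℝ} {V : ∀ i, E →L[ℝ] H i}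

lemma Geo.VV (g : Geo c V) (i : ι) (y : H i) : V i ((V i).adjoint y) = y := by
  let W : H i →ₗᵢ[ℝ] E := ⟨((V i).adjoint : H i →ₗ[ℝ] E), g.iso i⟩
  apply ext_inner_right ℝ
  intro v
  rw [← ContinuousLinearMap.adjoint_inner_right]
  exact W.inner_map_map y v

lemma Geo.dim (g : Geo c V) : (Module.finrank ℝ E : ℝ) = ∑ i, c i * Module.finrank ℝ (H i) := by
  have h : (LinearMap.id : E →ₗ[ℝ] E) = ∑ i, c i • (((V i).adjoint : H i →ₗ[ℝ] E) ∘ₗ (V i : E →ₗ[ℝ] H i)) := by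
    ext x
    simp only [LinearMap.sum_apply, LinearMap.smul_apply]
    exact (g.res x).symm
  have h2 := congrArg (LinearMap.trace ℝ E) h
  rw [LinearMap.trace_id, map_sum] at h2
  rw [h2]
  refine Finset.sum_congr rfl fun i _ => ?_
  rw [map_smul, LinearMap.trace_comp_comm']
  have : (V i : E →ₗ[ℝ] H i) ∘ₗ ((V i).adjoint : H i →ₗ[ℝ] E) = LinearMap.id := by
    ext y; exact g.VV i y
  rw [this, LinearMap.trace_id, smul_eq_mul]

lemma prod_rpow_unif (hc : ∀ i, 0 < c i) (M : ℝ) {ω : ℝ} (hω : 0 < ω) :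
    ∃ ε, 0 < ε ∧ ε ≤ 1 ∧ ∀ y : ι → ℝ, (∀ i, 0 ≤ y i) → (∀ i, y i ≤ M) →
      ∏ i, (y i + ε) ^ c i ≤ ∏ i, y i ^ c i + ω := by
  have hcont : Continuous (fun y : ι → ℝ => ∏ i, y i ^ c i) :=
    continuous_finsetProd _ fun i _ => (Real.continuous_rpow_const (hc i).le).comp (continuous_apply i)
  have hK : IsCompact (Set.pi Set.univ (fun _ : ι => Set.Icc (0 : ℝ) (M + 1))) :=
    isCompact_univ_pi fun _ => isCompact_Icc
  have hu := hK.uniformContinuousOn_of_continuous hcont.continuousOn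
  obtain ⟨δ, hδ, h⟩ := Metric.uniformContinuousOn_iff.1 hu ω hω
  refine ⟨min 1 (δ / 2), by positivity, min_le_left _ _, fun y h0 h1 => ?_⟩
  have hmin : 0 < min 1 (δ / 2) := by positivity
  have hm1 : min 1 (δ / 2) ≤ 1 := min_le_left _ _
  have := h (fun i => y i + min 1 (δ / 2)) (fun i _ => ⟨by linarith [h0 i], by linarith [h1 i]⟩) y
    (fun i _ => ⟨h0 i, by linarith [h1 i]⟩) (by
      rw [dist_pi_lt_iff hδ]
      intro i
      rw [Real.dist_eq, add_sub_cancel_left, abs_of_pos hmin]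
      exact (min_le_right _ _).trans_lt (by linarith))
  rw [Real.dist_eq] at this
  linarith [(abs_lt.1 this).2]

lemma Geo.heat_bdd (g : Geo c V) {h : ∀ i, H i → ℝ} (hm : ∀ i, Measurable (h i)) (h0 : ∀ i x, 0 ≤ h i x)
    {M R : ℝ} (hM : ∀ i x, h i x ≤ M) (hM0 : 0 ≤ M) (hR : ∀ i x, R < ‖x‖ → h i x = 0)
    {F : E → ℝ} (hF : Measurable F) (hF0 : ∀ x, 0 ≤ F x) (hFi : Integrable F)
    (hyp : ∀ x : ∀ i, H i, ∏ i, h i (x i) ^ c i ≤ F (Sm c V x)) {t : ℝ} (ht : 0 < t) :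
    ∏ i, heat t (h i) 0 ^ c i ≤ ck E t * ∫ x, F x := by
  refine le_of_forall_pos_le_add fun ω hω => ?_
  obtain ⟨ε, hε, hε1, hu⟩ := prod_rpow_unif g.pos M hω
  set B := ∏ i, M ^ c i with hB
  have hB0 : 0 ≤ B := Finset.prod_nonneg fun i _ => by positivity
  set G : E → ℝ := fun x => min (F x) B with hG
  have hGm : Measurable G := hF.min measurable_const
  have hG0 : ∀ x, 0 ≤ G x := fun x => le_min (hF0 x) hB0
  have hGB : ∀ x, G x ≤ B := fun x => min_le_right _ _
  have hGi : Integrable G := hFi.mono' hGm.aestronglyMeasurable (Filter.Eventually.of_forall fun x => by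
    rw [Real.norm_of_nonneg (hG0 x)]; exact min_le_left _ _)
  set ψ : ∀ i, H i → ℝ := fun i x => Real.log (h i x + ε) with hψ
  have ψm : ∀ i, Measurable (ψ i) := fun i => Real.measurable_log.comp ((hm i).add_const ε)
  set L := |Real.log ε| + |Real.log (M + ε)| with hL
  have ψL : ∀ i x, |ψ i x| ≤ L := by
    intro i x
    have a1 : Real.log ε ≤ ψ i x := Real.log_le_log hε (by linarith [h0 i x])
    have a2 : ψ i x ≤ Real.log (M + ε) := Real.log_le_log (by linarith [h0 i x]) (by linarith [hM i x])
    refine (abs_le_max_abs_abs a1 a2).trans (max_le ?_ ?_)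
    · rw [hL]; linarith [abs_nonneg (Real.log (M + ε))]
    · rw [hL]; linarith [abs_nonneg (Real.log ε)]
  have hexp : ∀ i x, Real.exp (ψ i x) = h i x + ε := fun i x => Real.exp_log (by linarith [h0 i x])
  have base : ∀ x : ∀ i, H i, Real.exp (∑ i, c i * ψ i (x i)) ≤ G (Sm c V x) + ω := by
    intro x
    rw [Real.exp_sum]
    have e : ∀ i, Real.exp (c i * ψ i (x i)) = (h i (x i) + ε) ^ c i := by
      intro i; rw [mul_comm, Real.exp_mul, hexp]
    simp only [e]
    refine (hu (fun i => h i (x i)) (fun i => h0 i _) (fun i => hM i _)).trans ?_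
    gcongr
    refine le_min (hyp x) ?_
    exact Finset.prod_le_prod (fun i _ => Real.rpow_nonneg (h0 i _) _) fun i _ =>
      Real.rpow_le_rpow (h0 i _) (hM i _) (g.pos i).le
  have hGωm : Measurable fun x => G x + ω := hGm.add_const ω
  have hGω : ∀ x, |G x + ω| ≤ B + ω := fun x => by
    rw [abs_of_nonneg (by linarith [hG0 x])]; linarith [hGB x]
  have sm : ∀ r (x : ∀ i, H i), Real.exp (∑ i, c i * heat r (ψ i) (x i)) ≤ heat r (fun x => G x + ω) (Sm c V x) := by
    intro r x
    have e1 : ∀ i, heat r (ψ i) (x i) = ∫ z, ψ i (x i + √r • V i z) ∂(stdGaussian E) := by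
      intro i
      unfold heat
      have mm : Measurable (fun z => ψ i (x i + √r • z)) := (ψm i).comp (by fun_prop)
      rw [← gauss_map (V i) (g.iso i), integral_map (V i).continuous.aemeasurable mm.aestronglyMeasurable]
    have ii : ∀ i, Integrable (fun z => ψ i (x i + √r • V i z)) (stdGaussian E) := fun i =>
      int_bdd L ((ψm i).comp (by fun_prop)).aestronglyMeasurable (fun z => ψL i _)
    have e2 : ∑ i, c i * heat r (ψ i) (x i) = ∫ z, ∑ i, c i * ψ i (x i + √r • V i z) ∂(stdGaussian E) := by
      rw [integral_finsetSum _ fun i _ => (ii i).const_mul _]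
      refine Finset.sum_congr rfl fun i _ => ?_
      rw [e1, integral_const_mul]
    have iS : Integrable (fun z => ∑ i, c i * ψ i (x i + √r • V i z)) (stdGaussian E) :=
      integrable_finsetSum _ fun i _ => (ii i).const_mul _
    have pt : ∀ z, Real.exp (∑ i, c i * ψ i (x i + √r • V i z)) ≤ G (Sm c V x + √r • z) + ω := by
      intro z
      have := base (fun i => x i + V i (√r • z))
      rw [g.sum_add] at this
      simpa only [map_smul] using this
    have iG : Integrable (fun z => G (Sm c V x + √r • z) + ω) (stdGaussian E) := heat_int hGωm hGω r _
    have iX : Integrable (fun z => Real.exp (∑ i, c i * ψ i (x i + √r • V i z))) (stdGaussian E) :=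
      iG.mono' (Real.continuous_exp.comp_aestronglyMeasurable iS.1) (Filter.Eventually.of_forall fun z => by
        rw [Real.norm_of_nonneg (Real.exp_pos _).le]; exact pt z)
    rw [e2]
    refine (convexOn_exp.map_integral_le Real.continuous_exp.continuousOn isClosed_univ
      (Filter.Eventually.of_forall fun _ => Set.mem_univ _) iS iX).trans ?_
    exact integral_mono iX iG pt
  have hck := ck_pos (E := E) ht
  have hF0' : 0 ≤ ∫ x, F x := integral_nonneg hF0
  have flow : ∀ r, 0 < r → ∑ i, c i * Real.log (heat t (fun y => Real.exp (heat r (ψ i) y)) 0) ≤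
      Real.log (ck E t * (∫ x, F x) + ω) := by
    intro r hr
    choose K a hK using fun i => nice_heat (ψm i) (ψL i) hr
    have bd := fun x => heat_le hGωm (α := ω) (β := B + ω) (fun x => by linarith [hG0 x]) (fun x => by linarith [hGB x]) r x
    have := g.flow (heat_meas hGωm r) hω (fun x => (bd x).1) (fun x => (bd x).2) hK (sm r) t ht.le (fun i => 0)
    refine this.trans ?_
    have hS : Sm c V (fun i => 0) = 0 := by simp [Sm]
    rw [hS, heat_heat hGωm hGω ht.le hr.le]
    have b2 := heat_le hGωm (α := ω) (β := B + ω) (fun x => by linarith [hG0 x]) (fun x => by linarith [hGB x]) (t + r) 0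
    apply Real.log_le_log (hω.trans_le b2.1)
    have e1 : heat (t + r) (fun x => G x + ω) 0 = heat (t + r) G 0 + ω := by
      have := integral_add (heat_int hGm (fun x => by rw [abs_of_nonneg (hG0 x)]; exact hGB x) (t + r) 0)
        (integrable_const (μ := stdGaussian E) ω)
      unfold heat
      rw [this]; simp
    rw [e1]
    gcongr
    refine (le_abs_self _).trans ((heat_abs_le hGi (by positivity) 0).trans ?_)
    have e2 : ck E (t + r) ≤ ck E t := by
      unfold ck
      apply Real.rpow_le_rpow_of_nonpos (by positivity)
      · have := Real.pi_pos; nlinarith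
      · have : (0:ℝ) ≤ Module.finrank ℝ E := by positivity
        linarith
    have e3 : ∫ y, |G y| ≤ ∫ x, F x := by
      refine integral_mono hGi.abs hFi fun x => ?_
      simp only [abs_of_nonneg (hG0 x)]
      exact min_le_left _ _
    exact mul_le_mul e2 e3 (integral_nonneg fun _ => abs_nonneg _) hck.le
  have hεh : ∀ i, heat t (fun y => Real.exp (ψ i y)) 0 = heat t (h i) 0 + ε := by
    intro i
    simp only [hexp]
    have := integral_add (heat_int (hm i) (fun x => by rw [abs_of_nonneg (h0 i x)]; exact hM i x) t 0)
        (integrable_const (μ := stdGaussian (H i)) ε)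
    unfold heat
    rw [this]; simp
  have hh0 : ∀ i, 0 ≤ heat t (h i) 0 := fun i => integral_nonneg fun z => h0 i _
  have lim : Filter.Tendsto (fun r : ℝ => ∑ i, c i * Real.log (heat t (fun y => Real.exp (heat r (ψ i) y)) 0))
      (nhdsWithin 0 (Set.Ioi 0)) (nhds (∑ i, c i * Real.log (heat t (h i) 0 + ε))) := by
    refine tendsto_finsetSum _ fun i _ => Filter.Tendsto.const_mul _ ?_
    refine Filter.Tendsto.log ?_ (by linarith [hh0 i])
    rw [← hεh]
    refine heat_exp_lim (k := Real.log ε) (ψm i) (ψL i) ?_ ht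
    have : Integrable ((Metric.closedBall (0 : H i) R).indicator fun _ => (2 * L : ℝ)) := by
      rw [integrable_indicator_iff measurableSet_closedBall]
      exact integrableOn_const (measure_closedBall_lt_top.ne)
    refine this.mono' ((ψm i).sub_const _).aestronglyMeasurable (Filter.Eventually.of_forall fun x => ?_)
    by_cases hx : x ∈ Metric.closedBall (0 : H i) R
    · rw [Set.indicator_of_mem hx]
      refine (norm_sub_le _ _).trans ?_
      rw [Real.norm_eq_abs, Real.norm_eq_abs]
      have := ψL i x
      have : |Real.log ε| ≤ L := by rw [hL]; linarith [abs_nonneg (Real.log (M + ε))]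
      linarith
    · rw [Set.indicator_of_notMem hx]
      have : h i x = 0 := hR i x (by simpa using hx)
      simp [hψ, this]
  have fin := le_of_tendsto lim (by filter_upwards [self_mem_nhdsWithin] with r hr using flow r hr)
  have hpos : 0 < ck E t * (∫ x, F x) + ω := by positivity
  rw [Real.le_log_iff_exp_le hpos, Real.exp_sum] at fin
  refine le_trans (Finset.prod_le_prod (fun i _ => Real.rpow_nonneg (hh0 i) _) fun i _ => ?_) fin
  rw [mul_comm, Real.exp_mul, Real.exp_log (by linarith [hh0 i])]
  exact Real.rpow_le_rpow (hh0 i) (by linarith) (g.pos i).le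

lemma Geo.bdd (g : Geo c V) {h : ∀ i, H i → ℝ} (hm : ∀ i, Measurable (h i)) (h0 : ∀ i x, 0 ≤ h i x)
    {M R : ℝ} (hM : ∀ i x, h i x ≤ M) (hM0 : 0 ≤ M) (hR : ∀ i x, R < ‖x‖ → h i x = 0)
    {F : E → ℝ} (hF : Measurable F) (hF0 : ∀ x, 0 ≤ F x) (hFi : Integrable F)
    (hyp : ∀ x : ∀ i, H i, ∏ i, h i (x i) ^ c i ≤ F (Sm c V x)) :
    (∀ i, Integrable (h i)) ∧ ∏ i, (∫ x, h i x) ^ c i ≤ ∫ x, F x := by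
  have hi : ∀ i, Integrable (h i) := by
    intro i
    have : Integrable ((Metric.closedBall (0 : H i) R).indicator fun _ => (M : ℝ)) := by
      rw [integrable_indicator_iff measurableSet_closedBall]
      exact integrableOn_const (measure_closedBall_lt_top.ne)
    refine this.mono' (hm i).aestronglyMeasurable (Filter.Eventually.of_forall fun x => ?_)
    by_cases hx : x ∈ Metric.closedBall (0 : H i) R
    · rw [Set.indicator_of_mem hx, Real.norm_of_nonneg (h0 i x)]; exact hM i x
    · rw [Set.indicator_of_notMem hx]
      have : h i x = 0 := hR i x (by simpa using hx)
      simp [this]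
  refine ⟨hi, ?_⟩
  have I0 : ∀ i, 0 ≤ ∫ x, h i x := fun i => integral_nonneg (h0 i)
  have key : ∀ t : ℝ, 0 < t → ∏ i, (Real.exp (-R ^ 2 / (2 * t)) * ∫ y, h i y) ^ c i ≤ ∫ x, F x := by
    intro t ht
    have k1 := g.heat_bdd hm h0 hM hM0 hR hF hF0 hFi hyp ht
    have k2 : ck E t * ∏ i, (Real.exp (-R ^ 2 / (2 * t)) * ∫ y, h i y) ^ c i ≤ ck E t * ∫ x, F x := by
      refine le_trans (le_of_eq ?_) ((Finset.prod_le_prod (fun i _ => ?_) fun i _ =>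
        Real.rpow_le_rpow ?_ (heat_lower (hi i) (h0 i) (hR i) ht) (g.pos i).le).trans k1)
      · have : ck E t = ∏ i, ck (H i) t ^ c i := by
          unfold ck
          rw [g.dim, ← Finset.sum_neg_distrib, Finset.sum_div, Real.rpow_sum_of_pos (by positivity)]
          refine Finset.prod_congr rfl fun i _ => ?_
          rw [← Real.rpow_mul (by positivity)]
          ring_nf
        rw [this, ← Finset.prod_mul_distrib]
        refine Finset.prod_congr rfl fun i _ => ?_
        rw [Real.mul_rpow (ck_pos ht).le (mul_nonneg (Real.exp_pos _).le (I0 i))]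
      · exact Real.rpow_nonneg (mul_nonneg (ck_pos ht).le (mul_nonneg (Real.exp_pos _).le (I0 i))) _
      · exact mul_nonneg (ck_pos ht).le (mul_nonneg (Real.exp_pos _).le (I0 i))
    exact le_of_mul_le_mul_left k2 (ck_pos ht)
  have lim : Filter.Tendsto (fun t : ℝ => ∏ i, (Real.exp (-R ^ 2 / (2 * t)) * ∫ y, h i y) ^ c i) Filter.atTop
      (nhds (∏ i, (Real.exp 0 * ∫ y, h i y) ^ c i)) := by
    refine tendsto_finsetProd _ fun i _ => ?_
    refine Filter.Tendsto.rpow_const (Filter.Tendsto.mul_const _ ?_) (Or.inr (g.pos i).le)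
    refine (Real.continuous_exp.tendsto 0).comp ?_
    refine Filter.Tendsto.const_div_atTop ?_ _
    exact Filter.tendsto_id.const_mul_atTop (by norm_num)
  have := le_of_tendsto lim (by filter_upwards [Filter.eventually_gt_atTop 0] with t ht using key t ht)
  simpa using this

end bdd
end Barthe
end part6

section part7
open MeasureTheory ProbabilityTheory
open scoped ENNReal RealInnerProductSpace
set_option linter.unusedSectionVars false
set_option linter.unusedVariables false
namespace Barthe
section main
variable {ι : Type*} [Fintype ι] {E : Type*} [NormedAddCommGroup E] [InnerProductSpace ℝ E] [FiniteDimensional ℝ E]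
  [MeasurableSpace E] [BorelSpace E] {H : ι → Type*} [∀ i, NormedAddCommGroup (H i)]
  [∀ i, InnerProductSpace ℝ (H i)] [∀ i, FiniteDimensional ℝ (H i)]
  [∀ i, MeasurableSpace (H i)] [∀ i, BorelSpace (H i)]
variable {c : ι → ℝ} {V : ∀ i, E →L[ℝ] H i}

lemma tendsto_prod_ne_zero {κ : Type*} (s : Finset κ) {u : κ → ℕ → ℝ≥0∞} {l : κ → ℝ≥0∞} (hl : ∀ i ∈ s, l i ≠ 0)
    (h : ∀ i ∈ s, Filter.Tendsto (u i) Filter.atTop (nhds (l i))) :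
    Filter.Tendsto (fun k => ∏ i ∈ s, u i k) Filter.atTop (nhds (∏ i ∈ s, l i)) := by
  classical
  induction s using Finset.induction_on with
  | empty => simp
  | insert a s ha ih =>
    simp only [Finset.prod_insert ha]
    refine ENNReal.Tendsto.mul (h a (by simp)) (Or.inl (hl a (by simp)))
      (ih (fun i hi => hl i (by simp [hi])) (fun i hi => h i (by simp [hi]))) (Or.inl ?_)
    exact Finset.prod_ne_zero_iff.2 fun i hi => hl i (by simp [hi])

theorem Geo.main (g : Geo c V) {h : ∀ i, H i → ℝ} (hm : ∀ i, Measurable (h i)) (h0 : ∀ i x, 0 ≤ h i x)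
    {F : E → ℝ} (hF : Measurable F) (hF0 : ∀ x, 0 ≤ F x)
    (hyp : ∀ x : ∀ i, H i, ∏ i, h i (x i) ^ c i ≤ F (Sm c V x)) :
    ∏ i, (∫⁻ x, ENNReal.ofReal (h i x)) ^ c i ≤ ∫⁻ x, ENNReal.ofReal (F x) := by
  by_cases hFt : ∫⁻ x, ENNReal.ofReal (F x) = ∞
  · rw [hFt]; exact le_top
  have hFi : Integrable F := by
    refine ⟨hF.aestronglyMeasurable, ?_⟩
    rw [hasFiniteIntegral_iff_ofReal (Filter.Eventually.of_forall hF0)]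
    exact lt_top_iff_ne_top.2 hFt
  by_cases hz : ∃ i, ∫⁻ x, ENNReal.ofReal (h i x) = 0
  · obtain ⟨i, hi⟩ := hz
    rw [Finset.prod_eq_zero (Finset.mem_univ i)]
    · exact zero_le
    · rw [hi, ENNReal.zero_rpow_of_pos (g.pos i)]
  push Not at hz
  let hk : ℕ → ∀ i, H i → ℝ := fun k i => (Metric.closedBall (0 : H i) k).indicator fun x => min (h i x) k
  have hk0 : ∀ k i x, 0 ≤ hk k i x := fun k i x =>
    Set.indicator_nonneg (fun x _ => le_min (h0 i x) (by positivity)) x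
  have hkm : ∀ k i, Measurable (hk k i) := fun k i =>
    ((hm i).min measurable_const).indicator measurableSet_closedBall
  have hkk : ∀ k i x, hk k i x ≤ k := fun k i x =>
    Set.indicator_le' (fun x _ => min_le_right _ _) (fun x _ => by positivity) x
  have hkh : ∀ k i x, hk k i x ≤ h i x := fun k i x =>
    Set.indicator_le' (fun x _ => min_le_left _ _) (fun x _ => h0 i x) x
  have step : ∀ k, ∏ i, (∫⁻ x, ENNReal.ofReal (hk k i x)) ^ c i ≤ ∫⁻ x, ENNReal.ofReal (F x) := by
    intro k
    obtain ⟨hi, hb⟩ := g.bdd (h := hk k) (M := k) (R := k) (hkm k) (hk0 k) (hkk k) (by positivity)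
      (fun i x hx => Set.indicator_of_notMem (by simpa using hx) _) hF hF0 hFi
      (fun x => (Finset.prod_le_prod (fun i _ => Real.rpow_nonneg (hk0 k i _) _) fun i _ =>
        Real.rpow_le_rpow (hk0 k i _) (hkh k i _) (g.pos i).le).trans (hyp x))
    rw [← ofReal_integral_eq_lintegral_ofReal hFi (Filter.Eventually.of_forall hF0)]
    refine le_trans (le_of_eq ?_) (ENNReal.ofReal_le_ofReal hb)
    rw [ENNReal.ofReal_prod_of_nonneg (fun i _ => Real.rpow_nonneg (integral_nonneg (hk0 k i)) _)]
    refine Finset.prod_congr rfl fun i _ => ?_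
    rw [← ENNReal.ofReal_rpow_of_nonneg (integral_nonneg (hk0 k i)) (g.pos i).le,
      ← ofReal_integral_eq_lintegral_ofReal (hi i) (Filter.Eventually.of_forall (hk0 k i))]
  have lim : ∀ i, Filter.Tendsto (fun k => ∫⁻ x, ENNReal.ofReal (hk k i x)) Filter.atTop
      (nhds (∫⁻ x, ENNReal.ofReal (h i x))) := by
    intro i
    refine lintegral_tendsto_of_tendsto_of_monotone (fun k => (hkm k i).ennreal_ofReal.aemeasurable)
      (Filter.Eventually.of_forall fun x => ?_) (Filter.Eventually.of_forall fun x => ?_)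
    · intro k l hkl
      apply ENNReal.ofReal_le_ofReal
      have hkl' : (k : ℝ) ≤ l := by exact_mod_cast hkl
      by_cases hx : x ∈ Metric.closedBall (0 : H i) k
      · have hx' : x ∈ Metric.closedBall (0 : H i) l := Metric.closedBall_subset_closedBall hkl' hx
        simp only [hk, Set.indicator_of_mem hx, Set.indicator_of_mem hx']
        exact min_le_min_left _ hkl'
      · simp only [hk, Set.indicator_of_notMem hx]
        exact hk0 l i x
    · refine tendsto_const_nhds.congr' ?_
      obtain ⟨N, hN⟩ := exists_nat_ge (max ‖x‖ (h i x))
      filter_upwards [Filter.eventually_ge_atTop N] with k hk'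
      have hkpp : (N : ℝ) ≤ k := by exact_mod_cast hk'
      have a1 := (le_max_left _ _).trans (hN.trans hkpp)
      have a2 := (le_max_right _ _).trans (hN.trans hkpp)
      simp only [hk]
      rw [Set.indicator_of_mem (by simpa using a1), min_eq_left a2]
  refine le_of_tendsto (tendsto_prod_ne_zero Finset.univ (fun i _ => ?_) (fun i _ =>
    (ENNReal.continuous_rpow_const.tendsto _).comp (lim i))) (Filter.Eventually.of_forall step)
  rw [Ne, ENNReal.rpow_eq_zero_iff]
  push Not
  exact ⟨fun h => absurd h (hz i), fun h => (g.pos i).le⟩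

end main
end Barthe
end part7

section part8
open MeasureTheory ProbabilityTheory Matrix
open scoped ENNReal RealInnerProductSpace
set_option linter.unusedSectionVars false
set_option linter.unusedVariables false
namespace Barthe
section mat

open scoped MatrixOrder in
lemma ex_root {k : ℕ} {A : Matrix (Fin k) (Fin k) ℝ} (hA : A.PosDef) :
    ∃ P : Matrix (Fin k) (Fin k) ℝ, A = P * Pᵀ ∧ P.det ≠ 0 := by
  obtain ⟨B, hB⟩ := CStarAlgebra.nonneg_iff_eq_star_mul_self.mp hA.posSemidef.nonneg
  refine ⟨Bᵀ, by rw [hB, transpose_transpose]; rfl, ?_⟩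
  intro h
  have := hA.det_pos
  rw [hB, det_mul, ← det_transpose B, h] at this
  simp at this

lemma posDef_block {k n : ℕ} {A : Matrix (Fin n) (Fin n) ℝ} (hA : A.PosDef) {U : Matrix (Fin k) (Fin n) ℝ}
    (hU : U.rank = k) : (U * A * Uᵀ).PosDef := by
  have : Function.Injective U.vecMul := by
    rw [Matrix.vecMul_injective_iff, linearIndependent_iff_card_eq_finrank_span, Fintype.card_fin]
    rw [Matrix.rank_eq_finrank_span_row] at hU
    exact hU.symm
  have := hA.mul_mul_conjTranspose_same this
  rwa [conjTranspose_eq_transpose_of_trivial] at this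

lemma lint_change {k : ℕ} {M : Matrix (Fin k) (Fin k) ℝ} (hM : M.det ≠ 0) {φ : (Fin k → ℝ) → ℝ≥0∞} (hφ : Measurable φ) :
    ∫⁻ y : EuclideanSpace ℝ (Fin k), φ (M⁻¹ *ᵥ y.ofLp) = ENNReal.ofReal |M.det| * ∫⁻ z, φ z := by
  have h1 : ∫⁻ y : EuclideanSpace ℝ (Fin k), φ (M⁻¹ *ᵥ y.ofLp) = ∫⁻ y : Fin k → ℝ, φ (M⁻¹ *ᵥ y) :=
    (PiLp.volume_preserving_ofLp (Fin k)).lintegral_comp (f := fun y => φ (M⁻¹ *ᵥ y))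
      (hφ.comp (by
        have : Continuous fun y : Fin k → ℝ => M⁻¹ *ᵥ y := by fun_prop
        exact this.measurable))
  have hM' : (M⁻¹).det ≠ 0 := by
    rw [det_nonsing_inv]; simpa using hM
  have h2 := Real.map_matrix_volume_pi_eq_smul_volume_pi hM'
  have h3 : ∫⁻ z, φ z ∂(Measure.map (toLin' M⁻¹) volume) = ∫⁻ y : Fin k → ℝ, φ (M⁻¹ *ᵥ y) := by
    rw [lintegral_map hφ]
    · simp
    · exact (LinearMap.continuous_of_finiteDimensional (toLin' M⁻¹)).measurable
  rw [h1, ← h3, h2, lintegral_smul_measure, smul_eq_mul, det_nonsing_inv]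
  simp

/-- matrix as a continuous linear map of Euclidean spaces -/
noncomputable def mclm {k l : ℕ} (W : Matrix (Fin k) (Fin l) ℝ) : EuclideanSpace ℝ (Fin l) →L[ℝ] EuclideanSpace ℝ (Fin k) :=
  LinearMap.toContinuousLinearMap (toEuclideanLin W)

lemma mclm_apply {k l : ℕ} (W : Matrix (Fin k) (Fin l) ℝ) (x : EuclideanSpace ℝ (Fin l)) :
    (mclm W x).ofLp = W *ᵥ x.ofLp := by
  simp [mclm, toEuclideanLin]

lemma mclm_adjoint {k l : ℕ} (W : Matrix (Fin k) (Fin l) ℝ) : (mclm W).adjoint = mclm Wᵀ := by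
  symm
  rw [ContinuousLinearMap.eq_adjoint_iff]
  intro x y
  simp only [EuclideanSpace.inner_eq_star_dotProduct, mclm_apply]
  simp only [star_trivial]
  rw [dotProduct_mulVec, vecMul_transpose, dotProduct_comm, dotProduct_comm]

lemma extract {m n : ℕ} {nn : Fin m → ℕ} (U : ∀ i, Matrix (Fin (nn i)) (Fin n) ℝ)
    (bigU : Matrix (Σ i : Fin m, Fin (nn i)) (Fin n) ℝ)
    (hbigU : ∀ a k, bigU a k = U a.1 a.2 k)
    (c : Fin m → ℝ) (A : Matrix (Fin n) (Fin n) ℝ)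
    (hAi : ∀ i, (U i * A * (U i)ᵀ).det ≠ 0)
    (DA : Matrix (Σ i : Fin m, Fin (nn i)) (Σ i : Fin m, Fin (nn i)) ℝ)
    (hDA : ∀ a b, DA a b = if a.1 = b.1 then (bigU * A * bigUᵀ) a b else 0)
    (hA2 : bigUᵀ * ((Matrix.diagonal fun a : Σ i : Fin m, Fin (nn i) => c a.1)
        * DA⁻¹) * bigU = A⁻¹) :
    ∑ i, c i • ((U i)ᵀ * (U i * A * (U i)ᵀ)⁻¹ * U i) = A⁻¹ := by
  have e1 : DA = blockDiagonal' (fun i => U i * A * (U i)ᵀ) := by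
    ext ⟨i, a⟩ ⟨j, b⟩
    rw [hDA]
    by_cases h : i = j
    · subst h
      rw [blockDiagonal'_apply_eq]
      simp [Matrix.mul_apply, hbigU]
    · rw [blockDiagonal'_apply_ne _ _ _ h]; simp [h]
  have e2 : DA⁻¹ = blockDiagonal' (fun i => (U i * A * (U i)ᵀ)⁻¹) := by
    apply inv_eq_right_inv
    rw [e1, ← blockDiagonal'_mul]
    have : (fun i => U i * A * (U i)ᵀ * (U i * A * (U i)ᵀ)⁻¹) = fun i => (1 : Matrix (Fin (nn i)) (Fin (nn i)) ℝ) := by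
      ext1 i; exact mul_nonsing_inv _ (isUnit_iff_ne_zero.2 (hAi i))
    rw [this]
    exact blockDiagonal'_one
  rw [← hA2, e2]
  generalize hB : (fun i => (U i * A * (U i)ᵀ)⁻¹) = B
  have hB' : ∀ i, (U i * A * (U i)ᵀ)⁻¹ = B i := fun i => congrFun hB i
  simp only [hB']
  have e3 : (Matrix.diagonal fun a : Σ i : Fin m, Fin (nn i) => c a.1) * blockDiagonal' B =
      blockDiagonal' (fun i => c i • B i) := by
    ext ⟨i, a⟩ ⟨j, b⟩
    rw [diagonal_mul]
    by_cases h : i = j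
    · subst h
      simp [blockDiagonal'_apply_eq]
    · simp [blockDiagonal'_apply_ne _ _ _ h]
  rw [e3]
  ext k l
  simp only [Matrix.sum_apply, Matrix.smul_apply, Matrix.mul_apply,
    Fintype.sum_sigma, Matrix.transpose_apply, hbigU, smul_eq_mul]
  refine Finset.sum_congr rfl fun i _ => ?_
  rw [Finset.mul_sum]
  refine Finset.sum_congr rfl fun b _ => ?_
  rw [Finset.sum_eq_single i]
  · rw [← mul_assoc, Finset.mul_sum]
    congr 1
    refine Finset.sum_congr rfl fun a _ => ?_
    rw [blockDiagonal'_apply_eq, Matrix.smul_apply, smul_eq_mul]; ring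
  · intro j _ hj
    refine Finset.sum_eq_zero fun a _ => ?_
    rw [blockDiagonal'_apply_ne _ _ _ hj]; simp
  · simp

end mat
end Barthe
end part8

open MeasureTheory Matrix
open scoped ENNReal

theorem stmt18
    (m n : ℕ) (hm : 0 < m) (hn : 0 < n)
    (nn : Fin m → ℕ) (hnn : ∀ i, 0 < nn i)
    (U : ∀ i, Matrix (Fin (nn i)) (Fin n) ℝ) (hUrank : ∀ i, (U i).rank = nn i)
    (bigU : Matrix (Σ i : Fin m, Fin (nn i)) (Fin n) ℝ)
    (hbigU : ∀ a k, bigU a k = U a.1 a.2 k)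
    (c : Fin m → ℝ) (hc : ∀ i, 0 < c i)
    (A : Matrix (Fin n) (Fin n) ℝ) (hA : A.PosDef)
    (DA : Matrix (Σ i : Fin m, Fin (nn i)) (Σ i : Fin m, Fin (nn i)) ℝ)
    (hDA : ∀ a b, DA a b = if a.1 = b.1 then (bigU * A * bigUᵀ) a b else 0)
    (hA2 : bigUᵀ * ((Matrix.diagonal fun a : Σ i : Fin m, Fin (nn i) => c a.1)
        * DA⁻¹) * bigU = A⁻¹)
    (f : (Fin n → ℝ) → ℝ) (hfm : Measurable f) (hf0 : ∀ x, 0 ≤ f x)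
    (g : ∀ i, (Fin (nn i) → ℝ) → ℝ) (hgm : ∀ i, Measurable (g i))
    (hg0 : ∀ i x, 0 ≤ g i x)
    (hcond : ∀ x : ∀ i, Fin (nn i) → ℝ,
      ∏ i, g i (x i) ≤ f (∑ i, c i • (U i)ᵀ.mulVec (x i))) :
    ∏ i, (∫⁻ z, ENNReal.ofReal (g i z) ^ (1 / c i)) ^ (c i)
      ≤ ENNReal.ofReal
          (Real.sqrt (A.det / ∏ i, (U i * A * (U i)ᵀ).det ^ (c i)))
        * ∫⁻ x, ENNReal.ofReal (f x) := by
  have hAi : ∀ i, (U i * A * (U i)ᵀ).PosDef := fun i => Barthe.posDef_block hA (hUrank i)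
  have hres := Barthe.extract U bigU hbigU c A (fun i => (hAi i).det_pos.ne') DA hDA hA2
  obtain ⟨P, hP, hPd⟩ := Barthe.ex_root hA
  choose Q hQ hQd using fun i => Barthe.ex_root (hAi i)
  have uP : IsUnit P.det := isUnit_iff_ne_zero.2 hPd
  have uPt : IsUnit Pᵀ.det := by rw [det_transpose]; exact uP
  have uQ : ∀ i, IsUnit (Q i).det := fun i => isUnit_iff_ne_zero.2 (hQd i)
  have uQt : ∀ i, IsUnit (Q i)ᵀ.det := fun i => by rw [det_transpose]; exact uQ i
  set W : ∀ i, Matrix (Fin (nn i)) (Fin n) ℝ := fun i => (Q i)⁻¹ * U i * P with hW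
  have hWt : ∀ i, (W i)ᵀ = Pᵀ * (U i)ᵀ * ((Q i)ᵀ)⁻¹ := by
    intro i
    rw [hW, transpose_mul, transpose_mul, transpose_nonsing_inv, Matrix.mul_assoc]
  have hWW : ∀ i, W i * (W i)ᵀ = 1 := by
    intro i
    calc W i * (W i)ᵀ = (Q i)⁻¹ * (U i * (P * Pᵀ) * (U i)ᵀ) * ((Q i)ᵀ)⁻¹ := by
          rw [hWt, hW]; simp only [Matrix.mul_assoc]
      _ = (Q i)⁻¹ * (Q i * (Q i)ᵀ) * ((Q i)ᵀ)⁻¹ := by rw [← hP, hQ i]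
      _ = 1 := by
        rw [← Matrix.mul_assoc, nonsing_inv_mul _ (uQ i), Matrix.one_mul, mul_nonsing_inv _ (uQt i)]
  have hsum : ∑ i, c i • ((W i)ᵀ * W i) = 1 := by
    have e : ∀ i, c i • ((W i)ᵀ * W i) = Pᵀ * (c i • ((U i)ᵀ * (U i * A * (U i)ᵀ)⁻¹ * U i)) * P := by
      intro i
      rw [hWt, hQ i, Matrix.mul_inv_rev, hW]
      simp only [Matrix.mul_assoc, Matrix.mul_smul, Matrix.smul_mul]
    simp only [e]
    rw [← Finset.sum_mul, ← Finset.mul_sum, hres, hP, Matrix.mul_inv_rev, ← Matrix.mul_assoc,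
      mul_nonsing_inv _ uPt, Matrix.one_mul, nonsing_inv_mul _ uP]
  have geo : Barthe.Geo (E := EuclideanSpace ℝ (Fin n)) (H := fun i => EuclideanSpace ℝ (Fin (nn i))) c
      (fun i => Barthe.mclm (W i)) := by
    refine ⟨hc, fun i y => ?_, fun x => ?_⟩
    · rw [Barthe.mclm_adjoint, ← sq_eq_sq₀ (norm_nonneg _) (norm_nonneg _), ← real_inner_self_eq_norm_sq,
        ← real_inner_self_eq_norm_sq, EuclideanSpace.inner_eq_star_dotProduct, EuclideanSpace.inner_eq_star_dotProduct,
        Barthe.mclm_apply, star_trivial, star_trivial, dotProduct_mulVec, vecMul_transpose, mulVec_mulVec, hWW, one_mulVec]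
    · apply (WithLp.ofLp_injective 2)
      have : ∀ i, (c i • (Barthe.mclm (W i)).adjoint (Barthe.mclm (W i) x)).ofLp = (c i • ((W i)ᵀ * W i)) *ᵥ x.ofLp := by
        intro i
        rw [WithLp.ofLp_smul, Barthe.mclm_adjoint, Barthe.mclm_apply, Barthe.mclm_apply, mulVec_mulVec, smul_mulVec]
      rw [WithLp.ofLp_sum]
      simp only [this]
      rw [← Matrix.sum_mulVec, hsum, one_mulVec]
  have mm : ∀ {k : ℕ} (M : Matrix (Fin k) (Fin k) ℝ), Measurable fun y : EuclideanSpace ℝ (Fin k) => M *ᵥ y.ofLp := by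
    intro k M
    have : Continuous fun y : EuclideanSpace ℝ (Fin k) => M *ᵥ y.ofLp := by fun_prop
    exact this.measurable
  have main := geo.main (h := fun i y => g i ((Q i)ᵀ⁻¹ *ᵥ y.ofLp) ^ (1 / c i)) (F := fun y => f (Pᵀ⁻¹ *ᵥ y.ofLp))
    (fun i => ((hgm i).comp (mm _)).pow_const _) (fun i x => Real.rpow_nonneg (hg0 i _) _)
    (hfm.comp (mm _)) (fun x => hf0 _) (fun x => by
      have e1 : ∀ i, (g i ((Q i)ᵀ⁻¹ *ᵥ (x i).ofLp) ^ (1 / c i)) ^ c i = g i ((Q i)ᵀ⁻¹ *ᵥ (x i).ofLp) := by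
        intro i
        rw [← Real.rpow_mul (hg0 i _), one_div, inv_mul_cancel₀ (hc i).ne', Real.rpow_one]
      simp only [e1]
      refine (hcond fun i => (Q i)ᵀ⁻¹ *ᵥ (x i).ofLp).trans (le_of_eq ?_)
      congr 1
      rw [Barthe.Sm, WithLp.ofLp_sum, Matrix.mulVec_sum]
      refine Finset.sum_congr rfl fun i _ => ?_
      rw [WithLp.ofLp_smul, Barthe.mclm_adjoint, Barthe.mclm_apply, hWt, mulVec_smul, mulVec_mulVec, mulVec_mulVec,
        ← Matrix.mul_assoc, ← Matrix.mul_assoc, nonsing_inv_mul _ uPt, Matrix.one_mul])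
  have i1 : ∫⁻ y : EuclideanSpace ℝ (Fin n), ENNReal.ofReal (f (Pᵀ⁻¹ *ᵥ y.ofLp)) =
      ENNReal.ofReal |P.det| * ∫⁻ x, ENNReal.ofReal (f x) := by
    rw [Barthe.lint_change (φ := fun z => ENNReal.ofReal (f z)) uPt.ne_zero (by fun_prop), det_transpose]
  have i2 : ∀ i, ∫⁻ y : EuclideanSpace ℝ (Fin (nn i)), ENNReal.ofReal (g i ((Q i)ᵀ⁻¹ *ᵥ y.ofLp) ^ (1 / c i)) =
      ENNReal.ofReal |(Q i).det| * ∫⁻ z, ENNReal.ofReal (g i z) ^ (1 / c i) := by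
    intro i
    have mg := hgm i
    rw [Barthe.lint_change (φ := fun z => ENNReal.ofReal (g i z ^ (1 / c i))) (uQt i).ne_zero (by fun_prop), det_transpose]
    congr 1
    refine lintegral_congr fun z => ?_
    rw [ENNReal.ofReal_rpow_of_nonneg (hg0 i z) (by have := hc i; positivity)]
  simp only at main
  rw [i1] at main
  simp only [i2] at main
  have dP : √(A.det) = |P.det| := by
    rw [hP, det_mul, det_transpose, Real.sqrt_mul_self_eq_abs]
  have dQ : ∀ i, (U i * A * (U i)ᵀ).det = |(Q i).det| ^ 2 := fun i => by
    rw [hQ i, det_mul, det_transpose, sq_abs, sq]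
  set D := ∏ i, |(Q i).det| ^ c i with hD
  have hD0 : 0 < D := Finset.prod_pos fun i _ => Real.rpow_pos_of_pos (abs_pos.2 (hQd i)) _
  have dD : √(∏ i, (U i * A * (U i)ᵀ).det ^ (c i)) = D := by
    have : ∏ i, (U i * A * (U i)ᵀ).det ^ (c i) = D ^ 2 := by
      rw [hD, ← Finset.prod_pow]
      refine Finset.prod_congr rfl fun i _ => ?_
      rw [dQ, ← Real.rpow_natCast, ← Real.rpow_natCast, ← Real.rpow_mul (abs_nonneg _), ← Real.rpow_mul (abs_nonneg _), mul_comm]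
    rw [this, Real.sqrt_sq hD0.le]
  rw [Real.sqrt_div hA.det_pos.le, dP, dD]
  have eD : ∏ i, (ENNReal.ofReal |(Q i).det| * ∫⁻ z, ENNReal.ofReal (g i z) ^ (1 / c i)) ^ c i =
      ENNReal.ofReal D * ∏ i, (∫⁻ z, ENNReal.ofReal (g i z) ^ (1 / c i)) ^ (c i) := by
    rw [hD, ENNReal.ofReal_prod_of_nonneg (fun i _ => Real.rpow_nonneg (abs_nonneg _) _), ← Finset.prod_mul_distrib]
    refine Finset.prod_congr rfl fun i _ => ?_
    rw [ENNReal.mul_rpow_of_nonneg _ _ (hc i).le, ENNReal.ofReal_rpow_of_nonneg (abs_nonneg _) (hc i).le]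
  rw [eD] at main
  have hDne : ENNReal.ofReal D ≠ 0 := by simpa using hD0
  have fin := mul_le_mul_right main (ENNReal.ofReal D)⁻¹
  rw [← mul_assoc, ENNReal.inv_mul_cancel hDne (by simp), one_mul, ← mul_assoc] at fin
  refine fin.trans (le_of_eq ?_)
  rw [div_eq_inv_mul, ENNReal.ofReal_mul (by positivity), ENNReal.ofReal_inv_of_pos hD0]
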